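/- There exists an absolute constant c > 0 such that for every integer n ≥ 2 and every n-point metric space M = (M,d), there is a starting point s ∈ M such that c·log n is a distributional lower bound for MSS on M with starting point s (with request sets of size at most n−1). Consequently, in every n-point metric space the randomized competitive ratio for MSS is Ω(log n). -/

import Mathlib

open scoped Classical

/-- `d` is a metric on `M`. -/
def IsMetric {M : Type*} (d : M → M → ℝ) : Prop :=
  (∀ x y, d x y = 0 ↔ x = y) ∧ (∀ x y, d x y = d y x) ∧
    ∀ x y z, d x z ≤ d x y + d y z

/-- The point occupied by the online algorithm `A` (with starting point `s`)
after serving the first `t` requests of `σ`. -/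
def mssPoint {M : Type*} (A : List (Finset M) → M) (s : M)
    (σ : List (Finset M)) (t : ℕ) : M :=
  if t = 0 then s else A (σ.take t)

/-- The cost of the deterministic online algorithm `A` on the MSS request
sequence `σ`, starting at `s`. -/
def mssCost {M : Type*} (d : M → M → ℝ) (A : List (Finset M) → M) (s : M)
    (σ : List (Finset M)) : ℝ :=
  ∑ t ∈ Finset.range σ.length, d (mssPoint A s σ t) (mssPoint A s σ (t + 1))

/-- `A` is a valid deterministic online algorithm for MSS: after each (nonempty)
prefix, it occupies a point of the last request. -/
def MssAlg {M : Type*} (A : List (Finset M) → M) : Prop :=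
  ∀ (l : List (Finset M)) (r : Finset M), r.Nonempty → A (l ++ [r]) ∈ r

/-- `x` is a feasible (offline) point sequence serving `σ` from `s`. -/
def MssServes {M : Type*} (s : M) (σ : List (Finset M)) (x : ℕ → M) : Prop :=
  x 0 = s ∧ ∀ (t : ℕ) (h : t < σ.length), x (t + 1) ∈ σ.get ⟨t, h⟩

/-- Optimal (offline) cost of serving `σ` from `s`. -/
noncomputable def mssOpt {M : Type*} (d : M → M → ℝ) (s : M)
    (σ : List (Finset M)) : ℝ :=
  sInf {c | ∃ x : ℕ → M, MssServes s σ x ∧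
    c = ∑ t ∈ Finset.range σ.length, d (x t) (x (t + 1))}

/-- `C` is a distributional lower bound for MSS on `(M,d)` with starting point `s`
and request sets of size at most `w`. -/
def MssDLB {M : Type*} (d : M → M → ℝ) (s : M) (w : ℕ) (C : ℝ) : Prop :=
  ∀ B : ℝ, 0 ≤ B → ∃ (N : ℕ) (P : Fin N → ℝ) (ρ : Fin N → List (Finset M)),
    (∀ ω, 0 ≤ P ω) ∧ (∑ ω, P ω) = 1 ∧
    (∀ ω, ∀ r ∈ ρ ω, r.Nonempty ∧ r.card ≤ w) ∧
    B ≤ (∑ ω, P ω * mssOpt d s (ρ ω)) ∧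
    ∀ A : List (Finset M) → M, MssAlg A →
      C * (∑ ω, P ω * mssOpt d s (ρ ω)) ≤ ∑ ω, P ω * mssCost d A s (ρ ω)

universe u

/-! ### Finite random experiments with uniform choices -/

/-- A finite random experiment: a tree of uniform finite choices. -/
inductive Expt (α : Type*) : Type _
  | pure (a : α) : Expt α
  | choice (n : ℕ) (f : Fin (n + 1) → Expt α) : Expt α

namespace Expt

variable {α β : Type*}

/-- Expectation of `f` under the experiment. -/
noncomputable def E : Expt α → (α → ℝ) → ℝ
  | pure a, f => f a
  | choice n g, f => (∑ i, E (g i) f) / (n + 1)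

/-- Sequential composition of experiments. -/
def bind : Expt α → (α → Expt β) → Expt β
  | pure a, k => k a
  | choice n g, k => choice n fun i => bind (g i) k

/-- `P` holds for every outcome. -/
def All (P : α → Prop) : Expt α → Prop
  | pure a => P a
  | choice _ g => ∀ i, All P (g i)

/-- Image of an experiment under a function. -/
def map (f : α → β) (D : Expt α) : Expt β := D.bind fun a => pure (f a)

/-- The uniform distribution on a finite nonempty type. -/
noncomputable def unif (α : Type*) [Fintype α] [Nonempty α] : Expt α :=
  choice (Fintype.card α - 1) fun i =>
    pure ((Fintype.equivFin α).symm
      (Fin.cast (Nat.succ_pred_eq_of_pos Fintype.card_pos) i))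

theorem E_pure (a : α) (f : α → ℝ) : E (pure a) f = f a := by rw [E]

theorem E_choice (n : ℕ) (g : Fin (n + 1) → Expt α) (f : α → ℝ) :
    E (choice n g) f = (∑ i, E (g i) f) / (n + 1) := by rw [E]

theorem E_bind (D : Expt α) (k : α → Expt β) (f : β → ℝ) :
    E (D.bind k) f = E D fun a => E (k a) f := by
  induction D with
  | pure a => rw [bind, E_pure]
  | choice n g ih => rw [bind, E_choice, E_choice]; simp only [ih]

theorem E_map (D : Expt α) (k : α → β) (f : β → ℝ) :
    E (D.map k) f = E D fun a => f (k a) := by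
  rw [map, E_bind]; simp only [E_pure]

theorem E_mono_of_all {P : α → Prop} {D : Expt α} (hD : D.All P) {f g : α → ℝ}
    (h : ∀ a, P a → f a ≤ g a) : E D f ≤ E D g := by
  induction D with
  | pure a => rw [E_pure, E_pure]; exact h a hD
  | choice n k ih =>
    rw [E_choice, E_choice]
    exact div_le_div_of_nonneg_right (Finset.sum_le_sum fun i _ => ih i (hD i)) (by positivity)

theorem all_true (D : Expt α) : D.All fun _ => True := by
  induction D with
  | pure a => trivial
  | choice n g ih => exact fun i => ih i

theorem all_mono {P Q : α → Prop} {D : Expt α} (h : D.All P) (hPQ : ∀ a, P a → Q a) :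
    D.All Q := by
  induction D with
  | pure a => exact hPQ a h
  | choice n g ih => exact fun i => ih i (h i)

theorem E_mono (D : Expt α) {f g : α → ℝ} (h : ∀ a, f a ≤ g a) : E D f ≤ E D g :=
  E_mono_of_all D.all_true fun a _ => h a

theorem E_congr_of_all {P : α → Prop} {D : Expt α} (hD : D.All P) {f g : α → ℝ}
    (h : ∀ a, P a → f a = g a) : E D f = E D g :=
  le_antisymm (E_mono_of_all hD fun a ha => (h a ha).le)
    (E_mono_of_all hD fun a ha => (h a ha).ge)

theorem E_add (D : Expt α) (f g : α → ℝ) : E D (fun a => f a + g a) = E D f + E D g := by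
  induction D with
  | pure a => simp only [E_pure]
  | choice n k ih => simp only [E_choice, ih, Finset.sum_add_distrib, add_div]

theorem E_mul (D : Expt α) (c : ℝ) (f : α → ℝ) : E D (fun a => c * f a) = c * E D f := by
  induction D with
  | pure a => simp only [E_pure]
  | choice n k ih => simp only [E_choice, ih, ← Finset.mul_sum, mul_div_assoc]

theorem E_const (D : Expt α) (c : ℝ) : E D (fun _ => c) = c := by
  induction D with
  | pure a => simp only [E_pure]
  | choice n k ih =>
    simp only [E_choice, ih, Finset.sum_const, Finset.card_univ, Fintype.card_fin, nsmul_eq_mul]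
    push_cast
    field_simp

theorem E_comm (D : Expt α) (D' : Expt β) (f : α → β → ℝ) :
    E D (fun a => E D' fun b => f a b) = E D' fun b => E D fun a => f a b := by
  induction D with
  | pure a => simp only [E_pure]
  | choice n k ih =>
    simp only [E_choice, ih]
    have hs : ∀ s : Finset (Fin (n + 1)), E D' (fun b => ∑ i ∈ s, E (k i) fun a => f a b)
        = ∑ i ∈ s, E D' fun b => E (k i) fun a => f a b := by
      intro s
      induction s using Finset.induction_on with
      | empty => simp [E_const]
      | insert i s hi ihs => simp only [Finset.sum_insert hi, E_add, ihs]
    have := E_mul D' ((n + 1 : ℝ)⁻¹) (fun b => ∑ i, E (k i) fun a => f a b)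
    simp only [div_eq_inv_mul]
    rw [this, hs]

theorem E_unif [Fintype α] [Nonempty α] (f : α → ℝ) :
    E (unif α) f = (∑ a, f a) / Fintype.card α := by
  have hc : Fintype.card α - 1 + 1 = Fintype.card α := Nat.succ_pred_eq_of_pos Fintype.card_pos
  rw [unif, E_choice]
  simp only [E_pure]
  congr 1
  · exact Fintype.sum_equiv ((finCongr hc).trans (Fintype.equivFin α).symm) _ _ fun i => rfl
  · exact_mod_cast hc

theorem all_bind {P : α → Prop} {Q : β → Prop} {D : Expt α} {k : α → Expt β}
    (hD : D.All P) (hk : ∀ a, P a → (k a).All Q) : (D.bind k).All Q := by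
  induction D with
  | pure a => exact hk a hD
  | choice n g ih => exact fun i => ih i (hD i)

theorem exists_weights (D : Expt α) :
    ∃ (N : ℕ) (P : Fin N → ℝ) (ρ : Fin N → α), (∀ ω, 0 ≤ P ω) ∧ (∑ ω, P ω) = 1 ∧
      (∀ f, E D f = ∑ ω, P ω * f (ρ ω)) ∧ ∀ Q, D.All Q → ∀ ω, Q (ρ ω) := by
  induction D with
  | pure a =>
    exact ⟨1, fun _ => 1, fun _ => a, fun _ => zero_le_one, by simp, fun f => by simp [E_pure],
      fun Q hQ _ => hQ⟩
  | choice n g ih =>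
    choose N P ρ h0 h1 hE hQ using ih
    have key : ∀ F : (Σ i, Fin (N i)) → ℝ,
        ∑ ω, F (finSigmaFinEquiv.symm ω) = ∑ i, ∑ j, F ⟨i, j⟩ := by
      intro F
      rw [← Fintype.sum_sigma]
      exact Fintype.sum_equiv finSigmaFinEquiv.symm _ _ fun _ => rfl
    refine ⟨_, fun ω => P (finSigmaFinEquiv.symm ω).1 (finSigmaFinEquiv.symm ω).2 / (n + 1),
      fun ω => ρ (finSigmaFinEquiv.symm ω).1 (finSigmaFinEquiv.symm ω).2,
      fun ω => div_nonneg (h0 _ _) (by positivity), ?_, fun f => ?_, fun Q hA ω => hQ _ Q (hA _) _⟩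
    · rw [key fun x => P x.1 x.2 / (n + 1)]
      simp only [← Finset.sum_div, h1]
      simpa using div_self (by positivity : (n + 1 : ℝ) ≠ 0)
    · rw [key fun x => P x.1 x.2 / (n + 1) * f (ρ x.1 x.2), E_choice, Finset.sum_div]
      refine Finset.sum_congr rfl fun i _ => ?_
      rw [hE, Finset.sum_div]
      exact Finset.sum_congr rfl fun j _ => by ring

/-- Concatenation of two independent random lists. -/
def seq (D D' : Expt (List α)) : Expt (List α) := D.bind fun l => D'.map fun l' => l ++ l'

/-- Concatenation of `n` independent copies of a random list. -/
def rep (D : Expt (List α)) : ℕ → Expt (List α)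
  | 0 => pure []
  | n + 1 => seq D (rep D n)

theorem E_seq (D D' : Expt (List α)) (f : List α → ℝ) :
    E (seq D D') f = E D fun l => E D' fun l' => f (l ++ l') := by
  rw [seq, E_bind]; simp only [E_map]

theorem E_rep_add (D : Expt (List α)) (m n : ℕ) (f : List α → ℝ) :
    E (rep D (m + n)) f = E (rep D m) fun l => E (rep D n) fun l' => f (l ++ l') := by
  induction m generalizing f with
  | zero => simp [rep, E_pure]
  | succ m ih =>
    rw [Nat.succ_add, rep, rep, E_seq, E_seq]
    simp only [ih, List.append_assoc]

theorem E_rep_rep (D : Expt (List α)) (k n : ℕ) (f : List α → ℝ) :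
    E (rep (rep D k) n) f = E (rep D (k * n)) f := by
  induction n generalizing f with
  | zero => simp [rep, E_pure]
  | succ n ih =>
    rw [rep, E_seq, Nat.mul_succ, Nat.add_comm, E_rep_add]
    simp only [ih]

theorem all_seq {P : α → Prop} {D D' : Expt (List α)} (h : D.All fun l => ∀ p ∈ l, P p)
    (h' : D'.All fun l => ∀ p ∈ l, P p) : (seq D D').All fun l => ∀ p ∈ l, P p := by
  refine all_bind h fun l hl => all_bind h' fun l' hl' p hp => ?_
  rcases List.mem_append.1 hp with hp | hp
  exacts [hl p hp, hl' p hp]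

theorem all_rep {P : α → Prop} {D : Expt (List α)} (h : D.All fun l => ∀ p ∈ l, P p) (n : ℕ) :
    (rep D n).All fun l => ∀ p ∈ l, P p := by
  induction n with
  | zero => intro p hp; simp at hp
  | succ n ih => exact all_seq h ih

end Expt

/-! ### Metrics -/

section Metric

variable {M : Type u} {d : M → M → ℝ}

theorem IsMetric.self (hd : IsMetric d) (x : M) : d x x = 0 := (hd.1 x x).2 rfl

theorem IsMetric.comm (hd : IsMetric d) (x y : M) : d x y = d y x := hd.2.1 x y

theorem IsMetric.tri (hd : IsMetric d) (x y z : M) : d x z ≤ d x y + d y z := hd.2.2 x y z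

theorem IsMetric.nonneg (hd : IsMetric d) (x y : M) : 0 ≤ d x y := by
  have := hd.tri x y x
  rw [hd.self, hd.comm y x] at this
  linarith

theorem IsMetric.pos (hd : IsMetric d) {x y : M} (h : x ≠ y) : 0 < d x y :=
  lt_of_le_of_ne (hd.nonneg x y) fun h0 => h ((hd.1 x y).1 h0.symm)

end Metric

/-! ### Online algorithms avoiding blocked points -/

section Online

variable {M : Type u} {d : M → M → ℝ}

/-- `A` answers every nonempty list of blocked points by a point of `U` other than the last
blocked one. -/
def Valid (U : Finset M) (A : List M → M) : Prop :=
  ∀ (l : List M) (p : M), A (l ++ [p]) ∈ U ∧ A (l ++ [p]) ≠ p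

/-- Cost of `A` on a list of blocked points. -/
def onl (d : M → M → ℝ) : (List M → M) → M → List M → ℝ
  | _, _, [] => 0
  | A, s, p :: l => d s (A [p]) + onl d (fun l' => A (p :: l')) (A [p]) l

/-- Final position of `A` on a list of blocked points. -/
def pos : (List M → M) → M → List M → M
  | _, s, [] => s
  | A, _, p :: l => pos (fun l' => A (p :: l')) (A [p]) l

theorem onl_append (A : List M → M) (s : M) (l l' : List M) :
    onl d A s (l ++ l') = onl d A s l + onl d (fun k => A (l ++ k)) (pos A s l) l' := by
  induction l generalizing A s with
  | nil => simp [onl, pos]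
  | cons p l ih => simp only [List.cons_append, onl, pos, ih]; ring

theorem pos_append (A : List M → M) (s : M) (l l' : List M) :
    pos A s (l ++ l') = pos (fun k => A (l ++ k)) (pos A s l) l' := by
  induction l generalizing A s with
  | nil => simp [pos]
  | cons p l ih => simp only [List.cons_append, pos, ih]

theorem Valid.append {U : Finset M} {A : List M → M} (h : Valid U A) (l : List M) :
    Valid U fun k => A (l ++ k) := by
  intro k p
  have := h (l ++ k) p
  rwa [List.append_assoc] at this

theorem Valid.pos_mem {U : Finset M} {A : List M → M} (h : Valid U A) {s : M} (hs : s ∈ U)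
    (l : List M) : pos A s l ∈ U := by
  induction l generalizing A s with
  | nil => exact hs
  | cons p l ih => exact ih (h.append [p]) (h [] p).1

/-- Serving the random list `D` raises the potential (a lower bound on the expected cost) from
`φ`, charged at the final position, to `φ'`, granted at the initial position. -/
def Lifts (d : M → M → ℝ) (U : Finset M) (D : Expt (List M)) (φ φ' : M → ℝ) : Prop :=
  ∀ A, Valid U A → ∀ s ∈ U, φ' s ≤ D.E fun l => onl d A s l + φ (pos A s l)

theorem Lifts.seq {U : Finset M} {D D' : Expt (List M)} {φ φ' φ'' : M → ℝ}
    (h' : Lifts d U D' φ φ') (h : Lifts d U D φ' φ'') : Lifts d U (Expt.seq D D') φ φ'' := by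
  intro A hA s hs
  rw [Expt.E_seq]
  refine (h A hA s hs).trans (Expt.E_mono _ fun l => ?_)
  simp only [onl_append, pos_append, add_assoc, Expt.E_add, Expt.E_const]
  have := h' _ (hA.append l) _ (hA.pos_mem hs l)
  rw [Expt.E_add] at this
  linarith

theorem Lifts.bind {α : Type*} {U : Finset M} {D : Expt α} {k : α → Expt (List M)} {φ : M → ℝ}
    {ψ : α → M → ℝ} (h : ∀ v, Lifts d U (k v) φ (ψ v)) :
    Lifts d U (D.bind k) φ fun x => D.E fun v => ψ v x := by
  intro A hA s hs
  rw [Expt.E_bind]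
  exact Expt.E_mono _ fun v => h v A hA s hs

theorem Lifts.mono {U : Finset M} {D : Expt (List M)} {φ φ' φ'' : M → ℝ}
    (h : Lifts d U D φ φ') (hle : ∀ x ∈ U, φ'' x ≤ φ' x) : Lifts d U D φ φ'' :=
  fun A hA s hs => (hle s hs).trans (h A hA s hs)

theorem lifts_nil (U : Finset M) (φ : M → ℝ) : Lifts d U (.pure []) φ φ := by
  intro A hA s hs
  simp [Expt.E_pure, onl, pos]

/-- The function with value `c` on `S` and `0` elsewhere. -/
noncomputable def ind (S : Finset M) (c : ℝ) (x : M) : ℝ := if x ∈ S then c else 0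

/-- The potential `φ` is constant on `S`, 1-Lipschitz away from `S`, and has slack `κ` between
`S` and its complement in `U`. -/
def Rob (d : M → M → ℝ) (U : Finset M) (φ : M → ℝ) (S : Finset M) (κ : ℝ) : Prop :=
  (∀ x ∈ S, ∀ y ∈ S, φ x = φ y) ∧
    (∀ x ∈ S, ∀ y ∈ U, y ∉ S → |φ x - φ y| + κ ≤ d x y) ∧
    ∀ x ∈ U, ∀ y ∈ U, x ∉ S → y ∉ S → |φ x - φ y| ≤ d x y

theorem Rob.add_ind {U S : Finset M} {φ : M → ℝ} {κ c : ℝ} (h : Rob d U φ S (κ + c))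
    (hc : 0 ≤ c) : Rob d U (fun x => φ x + ind S c x) S κ := by
  refine ⟨fun x hx y hy => ?_, fun x hx y hy hyS => ?_, fun x hx y hy hxS hyS => ?_⟩
  · simp [ind, hx, hy, h.1 x hx y hy]
  · have h1 := h.2.1 x hx y hy hyS
    simp only [ind, hx, hyS, if_true, if_false, add_zero]
    have : φ x + c - φ y = (φ x - φ y) + c := by ring
    rw [this]
    have := abs_add_le (φ x - φ y) c
    rw [abs_of_nonneg hc] at this
    linarith
  · simpa [ind, hxS, hyS] using h.2.2 x hx y hy hxS hyS

theorem lifts_block {U : Finset M} {p : M} {φ : M → ℝ} {c κ : ℝ}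
    (hc : c ≤ κ) (h : Rob d U φ {p} κ) :
    Lifts d U (.pure [p]) φ fun x => φ x + ind {p} c x := by
  intro A hA s hs
  have hq := hA [] p
  simp only [List.nil_append] at hq
  simp only [Expt.E_pure, onl, pos, add_zero, ind, Finset.mem_singleton]
  split_ifs with hsp
  · subst hsp
    have := h.2.1 s (by simp) _ hq.1 (by simpa using hq.2)
    have := le_abs_self (φ s - φ (A [s]))
    linarith
  · have := h.2.2 s hs _ hq.1 (by simpa using hsp) (by simpa using hq.2)
    have := le_abs_self (φ s - φ (A [p]))
    linarith

theorem lifts_rep {U S : Finset M} {D : Expt (List M)} {κ c : ℝ} (hc : 0 ≤ c)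
    (hD : ∀ φ, Rob d U φ S κ → Lifts d U D φ fun x => φ x + ind S c x) (N : ℕ) {φ : M → ℝ}
    (h : Rob d U φ S (κ + N * c)) :
    Lifts d U (D.rep N) φ fun x => φ x + ind S (N * c) x := by
  induction N generalizing φ with
  | zero => simpa [Expt.rep, ind] using lifts_nil (d := d) U φ
  | succ N ih =>
    have hNc : 0 ≤ N * c := by positivity
    have h1 : Rob d U φ S (κ + N * c) := by
      refine ⟨h.1, fun x hx y hy hyS => ?_, h.2.2⟩
      have := h.2.1 x hx y hy hyS
      push_cast at this
      linarith
    refine ((ih h1).seq (hD _ (h1.add_ind hNc))).mono fun x _ => ?_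
    simp only [ind]
    split_ifs
    · push_cast; linarith
    · linarith

/-- The experiment running, for each child `i` in the list with `v i`, the experiment `ch i`. -/
def slotOf {ι : Type} (ch : ι → Expt (List M)) (v : ι → Bool) : List ι → Expt (List M)
  | [] => .pure []
  | i :: L => Expt.seq (if v i then ch i else .pure []) (slotOf ch v L)

/-- One round at a node: every child is run with probability one half. -/
noncomputable def slot {ι : Type} [Fintype ι] (ch : ι → Expt (List M)) : Expt (List M) :=
  (Expt.unif (ι → Bool)).bind fun v => slotOf ch v Finset.univ.toList

theorem sum_prod_bool {ι : Type} [Fintype ι] (f : ι → Bool → ℝ) :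
    (Expt.unif (ι → Bool)).E (fun v => ∏ i, f i (v i)) = ∏ i, (f i true + f i false) / 2 := by
  rw [Expt.E_unif, Finset.prod_div_distrib]
  congr 1
  · have := Finset.prod_univ_sum (fun _ : ι => (Finset.univ : Finset Bool)) f
    simp only [Fintype.piFinset_univ, Fintype.sum_bool] at this
    exact this.symm
  · simp

theorem E_coin {ι : Type} [Fintype ι] (i : ι) (f : Bool → ℝ) :
    (Expt.unif (ι → Bool)).E (fun v => f (v i)) = (f true + f false) / 2 := by
  have := sum_prod_bool (fun j : ι => if j = i then f else fun _ => 1)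
  have h1 : ∀ v : ι → Bool, ∏ j, (if j = i then f else fun _ => 1) (v j) = f (v i) := by
    intro v
    rw [Finset.prod_eq_single i] <;> simp +contextual
  simp only [h1] at this
  rw [this, Finset.prod_eq_single i] <;> simp +contextual

theorem lifts_slotOf {ι : Type} {U : Finset M} (hd : IsMetric d) {S : ι → Finset M}
    {ch : ι → Expt (List M)} {c D : ℝ} (hc : 0 ≤ c) (hcD : 3 * c ≤ D) {T : Finset M}
    (hT : ∀ x, x ∈ T ↔ ∃ i, x ∈ S i)
    (hsep : ∀ i j, i ≠ j → ∀ x ∈ S i, ∀ y ∈ S j, D ≤ d x y)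
    (hch : ∀ i φ, Rob d U φ (S i) (2 * c) → Lifts d U (ch i) φ fun x => φ x + ind (S i) c x)
    {φ : M → ℝ} (hφ : Rob d U φ T (3 * c)) (v : ι → Bool) (L : List ι) (hL : L.Nodup) 
    (hdisj : ∀ i j x, x ∈ S i → x ∈ S j → i = j) :
    Lifts d U (slotOf ch v L) φ
      fun x => φ x + if ∃ j ∈ L, v j = true ∧ x ∈ S j then c else 0 := by
  induction L with
  | nil => simpa [slotOf] using lifts_nil (d := d) U φ
  | cons i L ih =>
    rw [List.nodup_cons] at hL
    rw [slotOf]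
    by_cases hi : v i = true
    · rw [if_pos hi]
      set g : M → ℝ := fun x => if ∃ j ∈ L, v j = true ∧ x ∈ S j then c else 0 with hg
      have g0 : ∀ x, 0 ≤ g x := fun x => by simp only [hg]; split_ifs <;> linarith
      have g1 : ∀ x, g x ≤ c := fun x => by simp only [hg]; split_ifs <;> linarith
      have gT : ∀ x, x ∉ T → g x = 0 := fun x hx => by
        simp only [hg]
        rw [if_neg]
        rintro ⟨j, -, -, hj⟩
        exact hx ((hT x).2 ⟨j, hj⟩)
      have gS : ∀ j, ∀ x ∈ S j, ∀ y ∈ S j, g x = g y := fun j x hx y hy => by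
        have : (∃ k ∈ L, v k = true ∧ x ∈ S k) ↔ ∃ k ∈ L, v k = true ∧ y ∈ S k := by
          constructor
          · rintro ⟨k, hk, hv, hxk⟩
            exact ⟨k, hk, hv, hdisj j k x hx hxk ▸ hy⟩
          · rintro ⟨k, hk, hv, hyk⟩
            exact ⟨k, hk, hv, hdisj j k y hy hyk ▸ hx⟩
        simp only [hg, this]
      have hmix : ∀ x y, |φ x + g x - (φ y + g y)| ≤ |φ x - φ y| + c := fun x y => by
        have e : φ x + g x - (φ y + g y) = (φ x - φ y) + (g x - g y) := by ring
        rw [e]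
        have := abs_add_le (φ x - φ y) (g x - g y)
        have h2 : |g x - g y| ≤ c := abs_le.2 ⟨by linarith [g0 x, g1 y], by linarith [g0 y, g1 x]⟩
        linarith
      have hin : ∀ j k, j ≠ k → ∀ x ∈ S j, ∀ y ∈ S k,
          |φ x + g x - (φ y + g y)| + 2 * c ≤ d x y := fun j k hjk x hx y hy => by
        have := hmix x y
        rw [hφ.1 x ((hT x).2 ⟨j, hx⟩) y ((hT y).2 ⟨k, hy⟩)] at this ⊢
        have := hsep j k hjk x hx y hy
        simp only [sub_self, abs_zero] at *
        linarith
      have hrob : Rob d U (fun x => φ x + g x) (S i) (2 * c) := by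
        refine ⟨fun x hx y hy => ?_, fun x hx y hy hyS => ?_, fun x hx y hy hxS hyS => ?_⟩
        · simp only [hφ.1 x ((hT x).2 ⟨i, hx⟩) y ((hT y).2 ⟨i, hy⟩), gS i x hx y hy]
        · by_cases hyT : y ∈ T
          · obtain ⟨j, hj⟩ := (hT y).1 hyT
            exact hin i j (fun h => hyS (h ▸ hj)) x hx y hj
          · have := hφ.2.1 x ((hT x).2 ⟨i, hx⟩) y hy hyT
            have := hmix x y
            linarith
        · by_cases hyT : y ∈ T
          · obtain ⟨j, hj⟩ := (hT y).1 hyT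
            by_cases hxT : x ∈ T
            · obtain ⟨k, hk⟩ := (hT x).1 hxT
              by_cases hkj : k = j
              · subst hkj
                simp only [hφ.1 x hxT y hyT, gS k x hk y hj]
                simpa using hd.nonneg x y
              · have := hin k j hkj x hk y hj
                linarith
            · have := hφ.2.1 y hyT x hx hxT
              have := hmix y x
              rw [hd.comm, abs_sub_comm]
              linarith
          · by_cases hxT : x ∈ T
            · have := hφ.2.1 x hxT y hy hyT
              have := hmix x y
              linarith
            · simp only [gT x hxT, gT y hyT]
              simpa using hφ.2.2 x hx y hy hxT hyT
      refine ((ih hL.2).seq (hch i _ hrob)).mono fun x _ => ?_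
      simp only [ind]
      by_cases hx : x ∈ S i
      · have hn : ¬ ∃ j ∈ L, v j = true ∧ x ∈ S j := by
          rintro ⟨j, hj, -, hxj⟩
          exact hL.1 (hdisj i j x hx hxj ▸ hj)
        simp [hx, hi, hn]
      · simp [hx]
    · rw [if_neg hi]
      refine ((ih hL.2).seq (lifts_nil _ _)).mono fun x _ => ?_
      simp [hi]

theorem lifts_slot {ι : Type} [Fintype ι] {U : Finset M} (hd : IsMetric d) {S : ι → Finset M}
    {ch : ι → Expt (List M)} {c D : ℝ} (hc : 0 ≤ c) (hD : 0 < D) (hcD : 3 * c ≤ D) {T : Finset M}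
    (hT : ∀ x, x ∈ T ↔ ∃ i, x ∈ S i)
    (hsep : ∀ i j, i ≠ j → ∀ x ∈ S i, ∀ y ∈ S j, D ≤ d x y)
    (hch : ∀ i φ, Rob d U φ (S i) (2 * c) → Lifts d U (ch i) φ fun x => φ x + ind (S i) c x)
    {φ : M → ℝ} (hφ : Rob d U φ T (3 * c)) :
    Lifts d U (slot ch) φ fun x => φ x + ind T (c / 2) x := by
  have hdisj : ∀ i j x, x ∈ S i → x ∈ S j → i = j := fun i j x hi hj => by
    by_contra hij
    have := hsep i j hij x hi x hj
    rw [hd.self] at this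
    linarith
  refine (Lifts.bind fun v => lifts_slotOf hd hc hcD hT hsep hch hφ v _
    (Finset.nodup_toList _) hdisj).mono fun x _ => ?_
  rw [Expt.E_add, Expt.E_const]
  refine add_le_add le_rfl (le_of_eq ?_)
  rw [ind]
  split_ifs with hx
  · obtain ⟨i, hi⟩ := (hT x).1 hx
    have : ∀ v : ι → Bool, (if ∃ j ∈ (Finset.univ : Finset ι).toList, v j = true ∧ x ∈ S j
        then c else 0) = (fun b => if b = true then c else 0) (v i) := fun v => by
      have : (∃ j ∈ (Finset.univ : Finset ι).toList, v j = true ∧ x ∈ S j) ↔ v i = true := by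
        constructor
        · rintro ⟨j, -, hv, hj⟩
          rwa [hdisj i j x hi hj]
        · exact fun h => ⟨i, by simp, h, hi⟩
      simp only [this]
    simp only [this]
    rw [E_coin i (fun b => if b = true then c else 0)]
    simp
  · have : ∀ v : ι → Bool, (if ∃ j ∈ (Finset.univ : Finset ι).toList, v j = true ∧ x ∈ S j
        then c else 0) = 0 := fun v => by
      rw [if_neg]
      rintro ⟨j, -, -, hj⟩
      exact hx ((hT x).2 ⟨j, hj⟩)
    simp only [this, Expt.E_const]

end Online

/-! ### Offline costs with penalties -/

section Offline

variable {M : Type u} {d : M → M → ℝ}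

/-- Offline cost of serving a list of blocked points inside `S` from `x` to `y`, where sitting at
the blocked point `p` is allowed at cost `pen p`. -/
noncomputable def oc (d : M → M → ℝ) (S : Finset M) (pen : M → ℝ) : M → List M → M → ℝ
  | x, [], y => d x y
  | x, p :: l, y => ⨅ z : S, (d x z + (if (z : M) = p then pen p else 0) + oc d S pen z l y)

theorem oc_cons_le (S : Finset M) (pen : M → ℝ) (x p : M) (l : List M) (y : M) {z : M}
    (hz : z ∈ S) :
    oc d S pen x (p :: l) y ≤ d x z + (if z = p then pen p else 0) + oc d S pen z l y := by
  rw [oc]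
  exact ciInf_le (Set.finite_range _).bddBelow (⟨z, hz⟩ : S)

theorem exists_oc_cons {S : Finset M} (hS : S.Nonempty) (pen : M → ℝ) (x p : M) (l : List M)
    (y : M) : ∃ z ∈ S,
    oc d S pen x (p :: l) y = d x z + (if z = p then pen p else 0) + oc d S pen z l y := by
  have : Nonempty S := hS.to_subtype
  obtain ⟨z, hz⟩ := exists_eq_ciInf_of_finite
    (f := fun z : S => d x z + (if (z : M) = p then pen p else 0) + oc d S pen z l y)
  exact ⟨z, z.2, by rw [oc]; exact hz.symm⟩

theorem oc_move (hd : IsMetric d) {S : Finset M} (hS : S.Nonempty) (pen : M → ℝ) (x z : M)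
    (l : List M) (y : M) : oc d S pen x l y ≤ d x z + oc d S pen z l y := by
  cases l with
  | nil => exact hd.tri x z y
  | cons p l =>
    obtain ⟨w, hw, e⟩ := exists_oc_cons (d := d) hS pen z p l y
    have := oc_cons_le (d := d) S pen x p l y hw
    have := hd.tri x z w
    linarith

theorem oc_append_le (hd : IsMetric d) {S : Finset M} (hS : S.Nonempty) (pen : M → ℝ)
    (x z : M) (a b : List M) (y : M) :
    oc d S pen x (a ++ b) y ≤ oc d S pen x a z + oc d S pen z b y := by
  induction a generalizing x with
  | nil => exact oc_move hd hS pen x z b y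
  | cons p l ih =>
    obtain ⟨w, hw, e⟩ := exists_oc_cons (d := d) hS pen x p l z
    have := oc_cons_le (d := d) S pen x p (l ++ b) y hw
    have := ih w
    rw [List.cons_append]
    linarith

theorem exists_oc_append_ge (hd : IsMetric d) {S : Finset M} (pen : M → ℝ)
    {x : M} (hx : x ∈ S) (a b : List M) (y : M) :
    ∃ z ∈ S, oc d S pen x a z + oc d S pen z b y ≤ oc d S pen x (a ++ b) y := by
  induction a generalizing x with
  | nil => exact ⟨x, hx, by simp [oc, hd.self]⟩
  | cons p l ih =>
    obtain ⟨w, hw, e⟩ := exists_oc_cons (d := d) ⟨x, hx⟩ pen x p (l ++ b) y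
    obtain ⟨z, hz, h⟩ := ih hw
    refine ⟨z, hz, ?_⟩
    have := oc_cons_le (d := d) S pen x p l z hw
    rw [List.cons_append, e]
    linarith

theorem oc_le_filter (hd : IsMetric d) {S S' : Finset M} (hSS : S' ⊆ S) (pen : M → ℝ) {x : M}
    (hx : x ∈ S') (l : List M) (y : M) :
    oc d S pen x l y ≤ oc d S' pen x (l.filter fun p => p ∈ S') y := by
  induction l generalizing x with
  | nil => exact le_rfl
  | cons p l ih =>
    by_cases hp : p ∈ S'
    · rw [List.filter_cons_of_pos (by simpa using hp)]
      obtain ⟨w, hw, e⟩ := exists_oc_cons (d := d) ⟨x, hx⟩ pen x p (l.filter fun p => p ∈ S') y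
      have := oc_cons_le (d := d) S pen x p l y (hSS hw)
      have := ih hw
      linarith
    · rw [List.filter_cons_of_neg (by simpa using hp)]
      have := oc_cons_le (d := d) S pen x p l y (hSS hx)
      rw [hd.self, if_neg (show ¬ x = p from fun h => hp (h ▸ hx))] at this
      have := ih hx
      linarith

theorem dist_le_oc (hd : IsMetric d) {S : Finset M} (hS : S.Nonempty) {pen : M → ℝ}
    (hpen : ∀ x, 0 ≤ pen x) (x : M) (l : List M) (y : M) : d x y ≤ oc d S pen x l y := by
  induction l generalizing x with
  | nil => exact le_rfl
  | cons p l ih =>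
    obtain ⟨w, hw, e⟩ := exists_oc_cons (d := d) hS pen x p l y
    have := ih w
    have := hd.tri x w y
    have : 0 ≤ if w = p then pen p else 0 := by split_ifs <;> simp [hpen]
    linarith

theorem oc_detour (hd : IsMetric d) {S : Finset M} (hS : S.Nonempty) (pen : M → ℝ) (x o : M)
    (l : List M) (y : M) : oc d S pen x l y ≤ d x o + oc d S pen o l o + d o y := by
  have h1 := oc_move hd hS pen x o l y
  have h2 := oc_append_le hd hS pen o o l [] y
  rw [List.append_nil] at h2
  rw [oc] at h2
  linarith

theorem oc_prefix_le (hd : IsMetric d) {S : Finset M} {pen : M → ℝ} (hpen : ∀ x, 0 ≤ pen x)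
    {o : M} (ho : o ∈ S) (a b : List M) : oc d S pen o a o ≤ oc d S pen o (a ++ b) o := by
  obtain ⟨z, hz, h⟩ := exists_oc_append_ge (d := d) hd pen ho a b o
  have h1 := dist_le_oc hd ⟨o, ho⟩ hpen z b o
  have h2 := oc_append_le hd ⟨o, ho⟩ pen o z a [] o
  rw [List.append_nil] at h2
  rw [oc] at h2
  linarith

/-! ### Admissible sets -/

/-- The penalties are nonnegative, and bounded by twice the distance to any other point of `S`
and by `2Δ`. -/
def PenOK (d : M → M → ℝ) (S : Finset M) (pen : M → ℝ) (Δ : ℝ) : Prop :=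
  (∀ x, 0 ≤ pen x) ∧ (∀ x ∈ S, ∀ y ∈ S, x ≠ y → pen x ≤ 2 * d x y) ∧ ∀ x ∈ S, pen x ≤ 2 * Δ

/-- There is a random list of blocked points of `S` which lifts every robust potential by
`Δ / 64` on `S`, while independent repetitions of it cost at most `Δ / X` each offline. -/
def Adm (d : M → M → ℝ) (S : Finset M) (Δ X : ℝ) : Prop :=
  ∃ ch : Expt (List M), (ch.All fun l => ∀ p ∈ l, p ∈ S) ∧
    (∀ (U : Finset M) (φ : M → ℝ), Rob d U φ S (2 * (Δ / 64)) →
      Lifts d U ch φ fun x => φ x + ind S (Δ / 64) x) ∧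
    ∃ o ∈ S, ∀ pen, PenOK d S pen Δ → ∀ T : ℕ,
      (ch.rep T).E (fun σ => oc d S pen o σ o) ≤ Δ * (T / X + 2)

theorem Adm.nonempty {S : Finset M} {Δ X : ℝ} (h : Adm d S Δ X) : S.Nonempty := by
  obtain ⟨ch, h1, h2, o, ho, h3⟩ := h
  exact ⟨o, ho⟩

theorem Rob.mono {U S : Finset M} {φ : M → ℝ} {κ κ' : ℝ} (h : Rob d U φ S κ) (hle : κ' ≤ κ) :
    Rob d U φ S κ' :=
  ⟨h.1, fun x hx y hy hyS => by have := h.2.1 x hx y hy hyS; linarith, h.2.2⟩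

theorem adm_singleton (hd : IsMetric d) (p : M) {Δ : ℝ} (hΔ : 0 ≤ Δ) :
    Adm d {p} Δ (1 / 2) := by
  refine ⟨.pure [p], fun q hq => by simpa using hq,
    fun U φ hφ => lifts_block (by linarith) hφ, p, by simp, fun pen hp T => ?_⟩
  have h : ∀ T : ℕ, (Expt.rep (.pure [p]) T).E (fun σ => oc d {p} pen p σ p) ≤ T * pen p := by
    intro T
    induction T with
    | zero => simp [Expt.rep, Expt.E_pure, oc, hd.self]
    | succ T ih =>
      rw [Expt.rep, Expt.E_seq, Expt.E_pure]
      have : ∀ l, oc d {p} pen p ([p] ++ l) p ≤ pen p + oc d {p} pen p l p := fun l => by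
        have := oc_cons_le (d := d) {p} pen p p l p (Finset.mem_singleton_self p)
        simpa [hd.self] using this
      refine (Expt.E_mono _ this).trans ?_
      rw [Expt.E_add, Expt.E_const]
      push_cast
      linarith
  refine (h T).trans ?_
  have := hp.2.2 p (by simp)
  have : (T : ℝ) * pen p ≤ T * (2 * Δ) := by gcongr
  have e : (T : ℝ) / (1 / 2) = 2 * T := by ring
  rw [e]
  linarith

theorem Adm.raise {S : Finset M} {Δ X : ℝ} (h : Adm d S Δ X) (hΔ : 0 ≤ Δ)
    (hS : ∀ x ∈ S, ∃ y ∈ S, x ≠ y ∧ d x y ≤ Δ) : Adm d S (4 * Δ) X := by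
  obtain ⟨ch, h1, h2, o, ho, h3⟩ := h
  refine ⟨ch.rep 4, Expt.all_rep h1 4, fun U φ hφ => ?_, o, ho, fun pen hp T => ?_⟩
  · have := lifts_rep (by positivity) (h2 U) 4 (φ := φ) (hφ.mono (by push_cast; linarith))
    convert this using 4
    push_cast
    ring
  · rw [Expt.E_rep_rep]
    refine (h3 pen ⟨hp.1, hp.2.1, fun x hx => ?_⟩ _).trans ?_
    · obtain ⟨y, hy, hxy, hxy'⟩ := hS x hx
      have := hp.2.1 x hx y hy hxy
      linarith
    · push_cast
      rw [mul_div_assoc]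
      nlinarith

end Offline

/-! ### Counting coins -/

section Coins

variable {ι : Type}

/-- Expectation of `f` at the number of heads among `W` fair coins. -/
noncomputable def binE : ℕ → (ℕ → ℝ) → ℝ
  | 0, f => f 0
  | W + 1, f => (binE W f + binE W fun t => f (t + 1)) / 2

theorem binE_mono (W : ℕ) {f g : ℕ → ℝ} (h : ∀ t, f t ≤ g t) : binE W f ≤ binE W g := by
  induction W generalizing f g with
  | zero => exact h 0
  | succ W ih =>
    have := ih h
    have := ih fun t => h (t + 1)
    simp only [binE]
    linarith

theorem binE_add (W : ℕ) (f g : ℕ → ℝ) :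
    binE W (fun t => f t + g t) = binE W f + binE W g := by
  induction W generalizing f g with
  | zero => rfl
  | succ W ih => simp only [binE, ih]; ring

theorem binE_mul (W : ℕ) (c : ℝ) (f : ℕ → ℝ) : binE W (fun t => c * f t) = c * binE W f := by
  induction W generalizing f with
  | zero => rfl
  | succ W ih => simp only [binE, ih]; ring

theorem binE_const (W : ℕ) (c : ℝ) : binE W (fun _ => c) = c := by
  induction W with
  | zero => rfl
  | succ W ih => simp only [binE, ih]; ring

theorem binE_id (W : ℕ) : binE W (fun t => (t : ℝ)) = W / 2 := by
  induction W with
  | zero => simp [binE]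
  | succ W ih =>
    simp only [binE, Nat.cast_add, Nat.cast_one, binE_add, binE_const, ih]
    ring

/-- The number of coin vectors of the list with `v i = true`. -/
def cnt (i : ι) : List (ι → Bool) → ℕ
  | [] => 0
  | v :: c => cnt i c + if v i then 1 else 0

/-- A list of `W` independent uniform coin vectors. -/
noncomputable def coins (ι : Type) [Fintype ι] (W : ℕ) : Expt (List (ι → Bool)) :=
  ((Expt.unif (ι → Bool)).map fun v => [v]).rep W

theorem E_coins_zero [Fintype ι] (f : List (ι → Bool) → ℝ) : (coins ι 0).E f = f [] := by
  rw [coins, Expt.rep, Expt.E_pure]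

theorem E_coins_succ [Fintype ι] (W : ℕ) (f : List (ι → Bool) → ℝ) :
    (coins ι (W + 1)).E f =
      (Expt.unif (ι → Bool)).E fun v => (coins ι W).E fun c => f (v :: c) := by
  rw [coins, Expt.rep, Expt.E_seq, Expt.E_map]
  rfl

theorem E_coins_prod [Fintype ι] (W : ℕ) (f : ι → ℕ → ℝ) :
    (coins ι W).E (fun c => ∏ i, f i (cnt i c)) = ∏ i, binE W (f i) := by
  induction W generalizing f with
  | zero => simp [E_coins_zero, cnt, binE]
  | succ W ih =>
    simp only [E_coins_succ, cnt]
    have : ∀ v : ι → Bool, (coins ι W).E (fun c => ∏ i, f i (cnt i c + if v i then 1 else 0))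
        = ∏ i, (fun b : Bool => binE W fun t => f i (t + if b then 1 else 0)) (v i) := fun v =>
      ih fun i t => f i (t + if v i then 1 else 0)
    simp only [this]
    rw [sum_prod_bool fun i (b : Bool) => binE W fun t => f i (t + if b then 1 else 0)]
    refine Finset.prod_congr rfl fun i _ => ?_
    simp only [binE, if_true, Bool.false_eq_true, if_false, add_zero]
    ring

theorem E_coins_one [Fintype ι] (W : ℕ) (i : ι) (f : ℕ → ℝ) :
    (coins ι W).E (fun c => f (cnt i c)) = binE W f := by
  have := E_coins_prod W fun j : ι => if j = i then f else fun _ => 1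
  have h1 : ∀ g : ι → ℕ, ∏ j, (if j = i then f else fun _ => 1) (g j) = f (g i) := by
    intro g
    rw [Finset.prod_eq_single i] <;> simp +contextual
  simp only [fun c => h1 fun j => cnt j c] at this
  rw [this, Finset.prod_eq_single i]
  · simp
  · intro j _ hj
    simp only [hj, if_false]
    exact binE_const W 1
  · simp

theorem E_coins_prod_mul [Fintype ι] (W : ℕ) (I : Finset ι) (i₀ : ι) (hi : i₀ ∉ I)
    (f : ι → ℕ → ℝ) (g : ℕ → ℝ) :
    (coins ι W).E (fun c => (∏ i ∈ I, f i (cnt i c)) * g (cnt i₀ c))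
      = (∏ i ∈ I, binE W (f i)) * binE W g := by
  have key : ∀ (F : ι → ℝ) (G : ℝ), ∏ i, (if i = i₀ then G else if i ∈ I then F i else 1)
      = (∏ i ∈ I, F i) * G := by
    intro F G
    rw [← Finset.mul_prod_erase _ _ (Finset.mem_univ i₀), if_pos rfl, mul_comm]
    congr 1
    rw [← Finset.prod_subset (show I ⊆ Finset.univ.erase i₀ from fun i hiI => by
      simp only [Finset.mem_erase, Finset.mem_univ, and_true]; rintro rfl; exact hi hiI)]
    · refine Finset.prod_congr rfl fun i hiI => ?_
      rw [if_neg (by rintro rfl; exact hi hiI), if_pos hiI]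
    · intro i hi' hiI
      rw [if_neg (Finset.ne_of_mem_erase hi'), if_neg hiI]
  have := E_coins_prod W fun i => if i = i₀ then g else if i ∈ I then f i else fun _ => 1
  have e1 : ∀ c : List (ι → Bool),
      ∏ i, (if i = i₀ then g else if i ∈ I then f i else fun _ => 1) (cnt i c)
      = (∏ i ∈ I, f i (cnt i c)) * g (cnt i₀ c) := fun c => by
    rw [← key]
    refine Finset.prod_congr rfl fun i _ => ?_
    by_cases h : i = i₀
    · subst h; simp
    · simp only [h, if_false]; split_ifs <;> rfl
  simp only [e1] at this
  rw [this, ← key]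
  refine Finset.prod_congr rfl fun i _ => ?_
  split_ifs
  · rfl
  · rfl
  · exact binE_const W 1

end Coins

/-! ### The offline cost at a node -/

section Node

variable {M : Type u} {d : M → M → ℝ} {ι : Type} [Fintype ι]

/-- The random blocked list with given coins. -/
noncomputable def realize (ch : ι → Expt (List M)) : List (ι → Bool) → Expt (List M)
  | [] => .pure []
  | v :: c => Expt.seq (slotOf ch v Finset.univ.toList) (realize ch c)

theorem E_rep_slot (ch : ι → Expt (List M)) (W : ℕ) (f : List M → ℝ) :
    ((slot ch).rep W).E f = (coins ι W).E fun c => (realize ch c).E f := by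
  induction W generalizing f with
  | zero => simp [Expt.rep, E_coins_zero, realize]
  | succ W ih =>
    rw [Expt.rep, Expt.E_seq, E_coins_succ]
    simp only [ih, realize, Expt.E_seq]
    rw [slot, Expt.E_bind]
    congr 1
    funext v
    rw [Expt.E_comm]

/-- The data of a node: disjoint children `S i` of the set `V` of diameter at most `Δ`, with
random lists `ch i` which cost at most `Δ (β i T + 2)` when repeated `T` times. -/
structure Kids (d : M → M → ℝ) (S : ι → Finset M) (ch : ι → Expt (List M)) (o : ι → M)
    (β : ι → ℝ) (V : Finset M) (pen : M → ℝ) (Δ : ℝ) : Prop where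
  metric : IsMetric d
  disj : ∀ i j x, x ∈ S i → x ∈ S j → i = j
  mem_iff : ∀ x, x ∈ V ↔ ∃ i, x ∈ S i
  pts : ∀ i, (ch i).All fun l => ∀ p ∈ l, p ∈ S i
  center : ∀ i, o i ∈ S i
  diam : ∀ x ∈ V, ∀ y ∈ V, d x y ≤ Δ
  scale_nonneg : 0 ≤ Δ
  off : ∀ i (T : ℕ), ((ch i).rep T).E (fun σ => oc d (S i) pen (o i) σ (o i)) ≤ Δ * (β i * T + 2)

namespace Kids

variable {S : ι → Finset M} {ch : ι → Expt (List M)} {o : ι → M} {β : ι → ℝ} {V : Finset M}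
  {pen : M → ℝ} {Δ : ℝ}

omit [Fintype ι] in
theorem E_slotOf_filter (K : Kids d S ch o β V pen Δ) (i : ι) (v : ι → Bool) (L : List ι)
    (hL : L.Nodup) (f : List M → ℝ) :
    (slotOf ch v L).E (fun σ => f (σ.filter fun p => p ∈ S i))
      = if i ∈ L ∧ v i = true then (ch i).E f else f [] := by
  induction L generalizing f with
  | nil => simp [slotOf, Expt.E_pure]
  | cons j L ih =>
    rw [List.nodup_cons] at hL
    rw [slotOf, Expt.E_seq]
    simp only [List.filter_append]
    simp only [fun l : List M => ih hL.2 fun σ => f (l ++ σ)]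
    by_cases hj : v j = true
    · rw [if_pos hj]
      by_cases hij : i = j
      · subst hij
        simp only [hL.1, false_and, if_false, List.append_nil, List.mem_cons, true_or, hj,
          and_self, if_true]
        refine Expt.E_congr_of_all (K.pts i) fun l hl => ?_
        rw [List.filter_eq_self.2 fun p hp => by simpa using hl p hp]
      · have : ∀ l : List M, (∀ p ∈ l, p ∈ S j) → (l.filter fun p => p ∈ S i) = [] :=
          fun l hl => List.filter_eq_nil_iff.2 fun p hp hpi =>
            hij (K.disj i j p (by simpa using hpi) (hl p hp))
        rw [Expt.E_congr_of_all (K.pts j) (fun l hl => by rw [this l hl]), Expt.E_const]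
        simp [hij]
    · rw [if_neg hj, Expt.E_pure]
      by_cases hij : i = j
      · subst hij
        simp [hj]
      · simp [hij]

theorem E_realize_filter (K : Kids d S ch o β V pen Δ) (i : ι) (c : List (ι → Bool))
    (f : List M → ℝ) :
    (realize ch c).E (fun σ => f (σ.filter fun p => p ∈ S i)) = ((ch i).rep (cnt i c)).E f := by
  induction c generalizing f with
  | nil => simp [realize, cnt, Expt.rep, Expt.E_pure]
  | cons v c ih =>
    rw [realize, Expt.E_seq, cnt]
    simp only [List.filter_append]
    simp only [fun l : List M => ih fun σ => f (l ++ σ)]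
    rw [K.E_slotOf_filter i v _ (Finset.nodup_toList _)
      fun l => ((ch i).rep (cnt i c)).E fun σ => f (l ++ σ)]
    by_cases hi : v i = true
    · simp [hi, Expt.rep, Expt.E_seq]
    · simp [hi]

/-- Serving `σ` inside `V` costs at most `c` more than serving `τ` inside `S i`, between any two
points of `S i`. -/
def Sim (d : M → M → ℝ) (S V : Finset M) (pen : M → ℝ) (σ τ : List M) (c : ℝ) : Prop :=
  ∀ x ∈ S, ∀ y ∈ S, oc d V pen x σ y ≤ oc d S pen x τ y + c

omit [Fintype ι] in
theorem subset (K : Kids d S ch o β V pen Δ) (i : ι) : S i ⊆ V :=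
  fun x hx => (K.mem_iff x).2 ⟨i, hx⟩

omit [Fintype ι] in
theorem sim_append (K : Kids d S ch o β V pen Δ) (i : ι) {σ τ σ' τ' : List M} {c c' : ℝ}
    (h : Sim d (S i) V pen σ τ c) (h' : Sim d (S i) V pen σ' τ' c') :
    Sim d (S i) V pen (σ ++ σ') (τ ++ τ') (c + c') := by
  intro x hx y hy
  obtain ⟨z, hz, hle⟩ := exists_oc_append_ge K.metric pen hx τ τ' y
  have := oc_append_le K.metric ⟨x, K.subset i hx⟩ pen x z σ σ' y
  have := h x hx z hz
  have := h' z hz y hy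
  linarith

omit [Fintype ι] in
theorem sim_stay (K : Kids d S ch o β V pen Δ) (i : ι) (σ : List M) :
    Sim d (S i) V pen σ (σ.filter fun p => p ∈ S i) 0 := by
  intro x hx y _
  rw [add_zero]
  exact oc_le_filter K.metric (K.subset i) pen hx σ y

omit [Fintype ι] in
theorem sim_leave (K : Kids d S ch o β V pen Δ) (i j : ι) (σ : List M) :
    Sim d (S i) V pen σ []
      (2 * Δ + oc d (S j) pen (o j) (σ.filter fun p => p ∈ S j) (o j)) := by
  intro x hx y hy
  have hj := K.subset j (K.center j)
  have h1 := oc_detour K.metric ⟨_, hj⟩ pen x (o j) σ y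
  have h2 := oc_le_filter K.metric (K.subset j) pen (K.center j) σ (o j)
  have h3 := K.diam x (K.subset i hx) _ hj
  have h4 := K.diam _ hj y (K.subset i hy)
  rw [oc]
  have := K.metric.nonneg x y
  linarith

/-- Number of rounds with heads for `i` in the windows where `i` is not left, over `n` windows
of length `W` followed by `r` rounds. -/
noncomputable def stays (i : ι) (pick : List (ι → Bool) → Option ι) (W r : ℕ) : ℕ → Expt ℕ
  | 0 => (coins ι r).map (cnt i)
  | n + 1 => (coins ι W).bind fun c =>
      (stays i pick W r n).map fun k => (if pick c = none then cnt i c else 0) + k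

theorem off_aux (K : Kids d S ch o β V pen Δ) (i : ι) (pick : List (ι → Bool) → Option ι)
    (W r n : ℕ) {σ₀ τ₀ : List M} {c₀ : ℝ} (h₀ : Sim d (S i) V pen σ₀ τ₀ c₀) :
    ((slot ch).rep (n * W + r)).E (fun σ => oc d V pen (o i) (σ₀ ++ σ) (o i)) ≤
      c₀ + n * (coins ι W).E (fun c =>
        (pick c).elim 0 fun j => Δ * (4 + β j * cnt j c)) +
      (stays i pick W r n).E fun k =>
        ((ch i).rep k).E fun τ => oc d (S i) pen (o i) (τ₀ ++ τ) (o i) := by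
  set H := (coins ι W).E (fun c => (pick c).elim 0 fun j => Δ * (4 + β j * cnt j c)) with hH
  have ho := K.center i
  induction n generalizing σ₀ τ₀ c₀ with
  | zero =>
    simp only [zero_mul, zero_add, Nat.cast_zero, add_zero, stays]
    rw [E_rep_slot, Expt.E_map, ← Expt.E_const (coins ι r) c₀, ← Expt.E_add]
    refine Expt.E_mono _ fun c => ?_
    rw [← K.E_realize_filter i c fun τ => oc d (S i) pen (o i) (τ₀ ++ τ) (o i),
      ← Expt.E_const (realize ch c) c₀, ← Expt.E_add]
    refine Expt.E_mono _ fun σ => ?_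
    have := K.sim_append i h₀ (K.sim_stay i σ) _ ho _ ho
    linarith
  | succ n ih =>
    have hW : (n + 1) * W + r = W + (n * W + r) := by ring
    rw [hW, Expt.E_rep_add, E_rep_slot, stays, Expt.E_bind]
    have hcoin : ∀ c : List (ι → Bool),
        (realize ch c).E (fun σ => ((slot ch).rep (n * W + r)).E fun σ' =>
          oc d V pen (o i) (σ₀ ++ (σ ++ σ')) (o i)) ≤
        c₀ + n * H + ((pick c).elim 0 fun j => Δ * (4 + β j * cnt j c)) +
        ((stays i pick W r n).map fun k => (if pick c = none then cnt i c else 0) + k).E fun k =>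
          ((ch i).rep k).E fun τ => oc d (S i) pen (o i) (τ₀ ++ τ) (o i) := by
      intro c
      rw [Expt.E_map]
      simp only [← List.append_assoc]
      cases hp : pick c with
      | none =>
        refine (Expt.E_mono _ fun σ => ih (K.sim_append i h₀ (K.sim_stay i σ))).trans
          (le_of_eq ?_)
        rw [Expt.E_add, Expt.E_const]
        simp only [Option.elim_none, if_true, List.append_assoc]
        rw [K.E_realize_filter i c fun l => (stays i pick W r n).E fun k =>
          ((ch i).rep k).E fun τ => oc d (S i) pen (o i) (τ₀ ++ (l ++ τ)) (o i), Expt.E_comm]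
        simp only [Expt.E_rep_add]
        ring
      | some j =>
        refine (Expt.E_mono _ fun σ => ih (K.sim_append i h₀ (K.sim_leave i j σ))).trans ?_
        simp only [Expt.E_add, Expt.E_const, List.append_nil]
        rw [K.E_realize_filter j c fun l => oc d (S j) pen (o j) l (o j)]
        have := K.off j (cnt j c)
        simp only [Option.elim_some, reduceCtorEq, if_false, zero_add]
        linarith
    refine (Expt.E_mono _ hcoin).trans (le_of_eq ?_)
    rw [Expt.E_add, Expt.E_add, Expt.E_const, ← hH]
    push_cast
    ring

theorem E_stays (i : ι) (pick : List (ι → Bool) → Option ι) (W r n : ℕ) :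
    (stays i pick W r n).E (fun k => (k : ℝ)) =
      n * (coins ι W).E (fun c => if pick c = none then (cnt i c : ℝ) else 0) + r / 2 := by
  induction n with
  | zero =>
    rw [stays, Expt.E_map, E_coins_one r i fun t => (t : ℝ), binE_id]
    simp
  | succ n ih =>
    rw [stays, Expt.E_bind]
    simp only [Expt.E_map, Nat.cast_add, Expt.E_add, Expt.E_const, ih]
    push_cast
    ring_nf

theorem off_pick (K : Kids d S ch o β V pen Δ) (i : ι) (pick : List (ι → Bool) → Option ι)
    (W r n : ℕ) :
    ((slot ch).rep (n * W + r)).E (fun σ => oc d V pen (o i) σ (o i)) ≤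
      Δ * (n * (coins ι W).E (fun c =>
        (pick c).elim (β i * cnt i c) fun j => 4 + β j * cnt j c) + β i * r / 2 + 2) := by
  have h0 : Sim d (S i) V pen [] [] 0 := fun x _ y _ => by simp [oc]
  refine (K.off_aux i pick W r n h0).trans ?_
  have h1 : (stays i pick W r n).E (fun k =>
        ((ch i).rep k).E fun τ => oc d (S i) pen (o i) ([] ++ τ) (o i)) ≤
      Δ * β i * (n * (coins ι W).E (fun c => if pick c = none then (cnt i c : ℝ) else 0) + r / 2)
        + Δ * 2 := by
    rw [← E_stays, ← Expt.E_mul, ← Expt.E_const (stays i pick W r n) (Δ * 2), ← Expt.E_add]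
    refine Expt.E_mono _ fun k => (K.off i k).trans (le_of_eq ?_)
    ring
  have h2 : (coins ι W).E (fun c => (pick c).elim (β i * cnt i c) fun j => 4 + β j * cnt j c) * Δ =
      (coins ι W).E (fun c => (pick c).elim 0 fun j => Δ * (4 + β j * cnt j c)) +
      Δ * β i * (coins ι W).E (fun c => if pick c = none then (cnt i c : ℝ) else 0) := by
    rw [mul_comm, ← Expt.E_mul, ← Expt.E_mul, ← Expt.E_add]
    congr 1
    funext c
    cases pick c with
    | none => simp; ring
    | some j => simp
  have h3 : Δ * (n * (coins ι W).E (fun c =>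
        (pick c).elim (β i * cnt i c) fun j => 4 + β j * cnt j c) + β i * r / 2 + 2) =
      n * ((coins ι W).E (fun c => (pick c).elim (β i * cnt i c) fun j => 4 + β j * cnt j c) * Δ)
      + Δ * (β i * r / 2 + 2) := by ring
  rw [h3, h2]
  linarith

/-- Cost of the strategy which stays at `i`, except in the windows where some `j ∈ I` has at most
`τ j` heads. -/
theorem off_window (K : Kids d S ch o β V pen Δ) (i : ι) (I : Finset ι) (hi : i ∉ I) (τ : ι → ℕ)
    {h : ℝ} (hβ : ∀ j, 0 ≤ β j) (hh : ∀ j ∈ I, 4 + β j * τ j ≤ h) (W r n : ℕ) :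
    ((slot ch).rep (n * W + r)).E (fun σ => oc d V pen (o i) σ (o i)) ≤
      Δ * (n * (h + (∏ j ∈ I, binE W fun t => if τ j < t then 1 else 0) * (β i * W / 2 - h))
        + β i * r / 2 + 2) := by
  set pick : List (ι → Bool) → Option ι := fun c =>
    if hc : ∃ j ∈ I, cnt j c ≤ τ j then some hc.choose else none with hpick
  refine (K.off_pick i pick W r n).trans ?_
  have hΔ := K.scale_nonneg
  have key : (coins ι W).E (fun c => (pick c).elim (β i * cnt i c) fun j => 4 + β j * cnt j c) ≤
      h + (∏ j ∈ I, binE W fun t => if τ j < t then 1 else 0) * (β i * W / 2 - h) := by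
    have e : β i * W / 2 - h = binE W fun t => β i * t + -h := by
      rw [binE_add, binE_mul, binE_id, binE_const]
      ring
    rw [e, ← E_coins_prod_mul W I i hi (fun j t => if τ j < t then 1 else 0)
      fun t => β i * t + -h, ← Expt.E_const (coins ι W) h, ← Expt.E_add]
    refine Expt.E_mono _ fun c => ?_
    rw [Expt.E_const]
    by_cases hc : ∃ j ∈ I, cnt j c ≤ τ j
    · have hs := hc.choose_spec
      simp only [hpick, dif_pos hc, Option.elim_some]
      rw [Finset.prod_eq_zero hs.1 (by rw [if_neg (not_lt.2 hs.2)]), zero_mul, add_zero]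
      refine le_trans ?_ (hh _ hs.1)
      have := hβ hc.choose
      have h' : (cnt hc.choose c : ℝ) ≤ τ hc.choose := by exact_mod_cast hs.2
      nlinarith
    · simp only [hpick, dif_neg hc, Option.elim_none]
      push Not at hc
      rw [Finset.prod_eq_one fun j hj => by rw [if_pos (hc j hj)]]
      linarith
  gcongr

end Kids

end Node

/-! ### Tails of the binomial distribution -/

section Tail

theorem binE_append (a b : ℕ) (f : ℕ → ℝ) :
    binE (a + b) f = binE a fun s => binE b fun t => f (s + t) := by
  induction a generalizing f with
  | zero => simp [binE]
  | succ a ih =>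
    rw [Nat.succ_add]
    simp only [binE, ih]
    congr 2
    exact congrArg _ (funext fun s => congrArg _ (funext fun t => congrArg f (by ring)))

theorem binE_symm (W : ℕ) (g : ℝ → ℝ) :
    binE W (fun t => g (2 * t - W)) = binE W fun t => g (W - 2 * t) := by
  induction W generalizing g with
  | zero => simp [binE]
  | succ W ih =>
    have h1 := ih fun s => g (s - 1)
    have h2 := ih fun s => g (s + 1)
    have e1 : (fun t : ℕ => g (2 * t - (W + 1 : ℕ))) = fun t : ℕ => g (2 * t - W - 1) :=
      funext fun t => congrArg g (by push_cast; ring)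
    have e2 : (fun t : ℕ => g (2 * (t + 1 : ℕ) - (W + 1 : ℕ))) = fun t : ℕ => g (2 * t - W + 1) :=
      funext fun t => congrArg g (by push_cast; ring)
    have e3 : (fun t : ℕ => g ((W + 1 : ℕ) - 2 * t)) = fun t : ℕ => g (W - 2 * t + 1) :=
      funext fun t => congrArg g (by push_cast; ring)
    have e4 : (fun t : ℕ => g ((W + 1 : ℕ) - 2 * (t + 1 : ℕ))) = fun t : ℕ => g (W - 2 * t - 1) :=
      funext fun t => congrArg g (by push_cast; ring)
    rw [binE, binE, e1, e2, e3, e4, h1, h2]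
    ring

theorem binE_sq (W : ℕ) : binE W (fun t => (2 * t - W : ℝ) ^ 2) = W := by
  induction W with
  | zero => simp [binE]
  | succ W ih =>
    have e : binE (W + 1) (fun t => (2 * t - (W + 1 : ℕ) : ℝ) ^ 2) =
        binE W fun t => (2 * t - W : ℝ) ^ 2 + 1 := by
      rw [binE, ← binE_add, div_eq_inv_mul, ← binE_mul]
      refine congrArg _ (funext fun t => ?_)
      push_cast
      ring
    rw [e, binE_add, ih, binE_const]
    push_cast
    ring

theorem binE_pow_four (W : ℕ) :
    binE W (fun t => (2 * t - W : ℝ) ^ 4) = 3 * (W : ℝ) ^ 2 - 2 * W := by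
  induction W with
  | zero => simp [binE]
  | succ W ih =>
    have e : binE (W + 1) (fun t => (2 * t - (W + 1 : ℕ) : ℝ) ^ 4) =
        binE W fun t => (2 * t - W : ℝ) ^ 4 + (6 * (2 * t - W : ℝ) ^ 2 + 1) := by
      rw [binE, ← binE_add, div_eq_inv_mul, ← binE_mul]
      refine congrArg _ (funext fun t => ?_)
      push_cast
      ring
    rw [e, binE_add, binE_add, ih, binE_mul, binE_sq, binE_const]
    push_cast
    ring

theorem binE_tail_sq (k : ℕ) (hk : 1 ≤ k) :
    1 / 10 ≤ binE (k ^ 2) fun t => if (t : ℝ) ≤ (k : ℝ) ^ 2 / 2 - k / 4 then 1 else 0 := by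
  set W := k ^ 2 with hW
  have hk' : (1 : ℝ) ≤ k := by exact_mod_cast hk
  have hWk : (W : ℝ) = (k : ℝ) ^ 2 := by rw [hW]; push_cast; ring
  have hW0 : (0 : ℝ) < W := by rw [hWk]; positivity
  have hs := binE_symm W fun s => if s ≤ -(k / 2 : ℝ) then 1 else 0
  have h1 : ∀ t : ℕ, (if (2 * t - W : ℝ) ≤ -(k / 2 : ℝ) then (1 : ℝ) else 0)
      = if (t : ℝ) ≤ (k : ℝ) ^ 2 / 2 - k / 4 then 1 else 0 := fun t => by
    congr 1
    rw [hWk, eq_iff_iff]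
    constructor <;> intro h <;> linarith
  simp only [h1] at hs
  have hpt : ∀ t : ℕ, (33 / 4 * (W : ℝ)⁻¹) * (2 * t - W : ℝ) ^ 2
      + (-2 + -((W : ℝ)⁻¹ ^ 2) * (2 * t - W : ℝ) ^ 4) ≤
      (31 / 2 : ℝ) * (if (t : ℝ) ≤ (k : ℝ) ^ 2 / 2 - k / 4 then 1 else 0)
      + 31 / 2 * (if (W - 2 * t : ℝ) ≤ -(k / 2 : ℝ) then 1 else 0) := by
    intro t
    rw [← h1]
    set s : ℝ := 2 * t - W with hs
    have e : (W - 2 * t : ℝ) = -s := by rw [hs]; ring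
    rw [e]
    set u : ℝ := (W : ℝ)⁻¹ * s ^ 2 with hu
    have eu : (33 / 4 * (W : ℝ)⁻¹) * s ^ 2 + (-2 + -((W : ℝ)⁻¹ ^ 2) * s ^ 4)
        = 33 / 4 * u - 2 - u ^ 2 := by rw [hu]; ring
    rw [eu]
    by_cases ha : s ≤ -(k / 2 : ℝ)
    · rw [if_pos ha]
      have : (0 : ℝ) ≤ if -s ≤ -(k / 2 : ℝ) then 1 else 0 := by split_ifs <;> norm_num
      nlinarith [sq_nonneg (u - 33 / 8)]
    · by_cases hb : -s ≤ -(k / 2 : ℝ)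
      · rw [if_neg ha, if_pos hb]
        nlinarith [sq_nonneg (u - 33 / 8)]
      · rw [if_neg ha, if_neg hb]
        push Not at ha hb
        have hsq : s ^ 2 ≤ (k / 2 : ℝ) ^ 2 := sq_le_sq' (by linarith) (by linarith)
        have hu4 : u ≤ 1 / 4 := by
          rw [hu, inv_mul_le_iff₀ hW0, hWk]
          linarith
        nlinarith
  have h2 := binE_mono W hpt
  rw [binE_add, binE_add, binE_add, binE_mul, binE_mul, binE_mul, binE_mul, binE_const, binE_sq,
    binE_pow_four, ← hs] at h2
  rw [show 33 / 4 * (W : ℝ)⁻¹ * W = 33 / 4 by field_simp, neg_mul] at h2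
  have h4 : (W : ℝ)⁻¹ ^ 2 * (3 * (W : ℝ) ^ 2 - 2 * W) ≤ 3 := by
    have : (W : ℝ)⁻¹ ^ 2 * (3 * (W : ℝ) ^ 2 - 2 * W) = 3 - 2 * (W : ℝ)⁻¹ := by field_simp
    rw [this]
    have : 0 ≤ (W : ℝ)⁻¹ := by positivity
    linarith
  linarith

theorem binE_tail (N k : ℕ) (hk : 1 ≤ k) :
    (1 / 10 : ℝ) ^ N ≤
      binE (N * k ^ 2) fun t => if (t : ℝ) ≤ N * ((k : ℝ) ^ 2 / 2 - k / 4) then 1 else 0 := by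
  induction N with
  | zero => simp [binE]
  | succ N ih =>
    have e : (N + 1) * k ^ 2 = N * k ^ 2 + k ^ 2 := by ring
    rw [e, binE_append, pow_succ]
    have h1 := binE_tail_sq k hk
    have h2 : ∀ s : ℕ, (1 / 10) * (if (s : ℝ) ≤ N * ((k : ℝ) ^ 2 / 2 - k / 4) then 1 else 0) ≤
        binE (k ^ 2) fun t => if ((s + t : ℕ) : ℝ) ≤ (N + 1 : ℕ) * ((k : ℝ) ^ 2 / 2 - k / 4)
          then (1 : ℝ) else 0 := by
      intro s
      split_ifs with hs
      · rw [mul_one]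
        refine h1.trans (binE_mono _ fun t => ?_)
        by_cases ht : (t : ℝ) ≤ (k : ℝ) ^ 2 / 2 - k / 4
        · rw [if_pos ht, if_pos]
          push_cast
          linarith
        · rw [if_neg ht]
          split_ifs <;> norm_num
      · rw [mul_zero, ← binE_const (k ^ 2) 0]
        exact binE_mono _ fun t => by rw [binE_const]; split_ifs <;> norm_num
    have h3 := binE_mono (N * k ^ 2) h2
    rw [binE_mul] at h3
    linarith

theorem binE_zero (W : ℕ) : binE W (fun t => if t ≤ 0 then 1 else 0) = (1 / 2) ^ W := by
  induction W with
  | zero => simp [binE]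
  | succ W ih =>
    rw [binE, ih]
    simp [binE_const, pow_succ]
    ring

theorem binE_lt (W τ : ℕ) : binE W (fun t => if τ < t then 1 else 0) =
    1 - binE W fun t => if t ≤ τ then 1 else 0 := by
  rw [eq_sub_iff_add_eq, ← binE_add, ← binE_const W 1]
  refine congrArg _ (funext fun t => ?_)
  rw [binE_const]
  by_cases h : t ≤ τ
  · simp [h]
  · simp [h, not_le.1 h]

theorem binE_lt_nonneg (W τ : ℕ) : 0 ≤ binE W fun t => if τ < t then 1 else 0 := by
  rw [← binE_const W 0]
  exact binE_mono _ fun t => by rw [binE_const]; split_ifs <;> norm_num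

theorem one_sub_pow_mul_le (N : ℕ) {p : ℝ} (h0 : 0 ≤ p) (h1 : p ≤ 1) :
    (1 - p) ^ N * (1 + N * p) ≤ 1 := by
  have hb := one_add_mul_le_pow (show (-2 : ℝ) ≤ p by linarith) N
  have h2 : (1 - p) ^ N * (1 + p) ^ N ≤ 1 := by
    rw [← mul_pow]
    exact pow_le_one₀ (by nlinarith) (by nlinarith)
  have h3 : 0 ≤ (1 - p) ^ N := pow_nonneg (by linarith) N
  nlinarith

end Tail

/-! ### Nodes are admissible -/

/-- The numerical condition under which a node whose children have values `X` has value `Y`. -/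
def Plan {ι : Type} (X : ι → ℝ) (Y : ℝ) : Prop :=
  ∃ i₀, ∀ T : ℕ, ∃ (n W r : ℕ) (I : Finset ι) (τ : ι → ℕ) (h : ℝ), T ≤ n * W + r ∧ i₀ ∉ I ∧
    (∀ j ∈ I, 4 + τ j / X j ≤ h) ∧
    n * (h + (∏ j ∈ I, binE W fun t => if τ j < t then 1 else 0) * (W / X i₀ / 2 - h))
      + r / X i₀ / 2 + 2 ≤ T / (2 * Y) + 8

section NodeAdm

variable {M : Type u} {d : M → M → ℝ} {ι : Type} [Fintype ι]

theorem adm_node (hd : IsMetric d) {S : ι → Finset M} {V : Finset M} {Δ : ℝ} (hΔ : 0 < Δ)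
    (hne : ∀ i : ι, ∃ j, j ≠ i) (hV : ∀ x, x ∈ V ↔ ∃ i, x ∈ S i)
    (hsep : ∀ i j, i ≠ j → ∀ x ∈ S i, ∀ y ∈ S j, Δ / 16 ≤ d x y)
    (hdiam : ∀ x ∈ V, ∀ y ∈ V, d x y ≤ Δ) {X : ι → ℝ} (hX : ∀ i, 0 < X i)
    (hA : ∀ i, Adm d (S i) Δ (X i)) {Y : ℝ} (hY : Plan X Y) :
    Adm d V (4 * Δ) Y := by
  obtain ⟨i₀, hnum⟩ := hY
  choose ch hpts hlift o ho hoff using hA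
  have hdisj : ∀ i j x, x ∈ S i → x ∈ S j → i = j := fun i j x hi hj => by
    by_contra hij
    have := hsep i j hij x hi x hj
    rw [hd.self] at this
    linarith
  have hsub : ∀ i, S i ⊆ V := fun i x hx => (hV x).2 ⟨i, hx⟩
  refine ⟨(slot ch).rep 8, Expt.all_rep ?_ 8, fun U φ hφ => ?_, o i₀, hsub _ (ho _),
    fun pen hp T => ?_⟩
  · refine Expt.all_bind (Expt.all_true _) fun v _ => ?_
    induction (Finset.univ : Finset ι).toList with
    | nil => intro p hp; simp at hp
    | cons i L ih =>
      refine Expt.all_seq ?_ ih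
      split_ifs
      · have h := hpts i
        refine Expt.all_mono h fun l hl p hp => hsub i (hl p hp)
      · intro p hp; simp at hp
  · have := lifts_rep (D := slot ch) (S := V) (U := U) (d := d) (κ := 3 * (Δ / 64))
      (c := Δ / 64 / 2) (by positivity)
      (fun φ hφ => lifts_slot hd (by positivity) (by positivity : (0 : ℝ) < Δ / 16)
        (by linarith) hV hsep (fun i => hlift i U) hφ) 8 (φ := φ)
        (hφ.mono (by push_cast; linarith))
    convert this using 4
    push_cast
    ring
  · have hK : Kids d S ch o (fun i => (X i)⁻¹) V pen Δ :=
      { metric := hd, disj := hdisj, mem_iff := hV, pts := hpts, center := ho, diam := hdiam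
        scale_nonneg := hΔ.le
        off := fun i T => by
          refine (hoff i pen ⟨hp.1, fun x hx y hy => hp.2.1 x (hsub i hx) y (hsub i hy),
            fun x hx => ?_⟩ T).trans (le_of_eq (by ring))
          obtain ⟨j, hj⟩ := hne i
          have hy := ho j
          have := hp.2.1 x (hsub i hx) (o j) (hsub j hy)
            (fun h => hj (hdisj j i (o j) hy (h ▸ hx)))
          have := hdiam x (hsub i hx) (o j) (hsub j hy)
          linarith }
    rw [Expt.E_rep_rep]
    obtain ⟨n, W, r, I, τ, h, hT, hI, hh, hle⟩ := hnum (8 * T)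
    obtain ⟨e, he⟩ := Nat.exists_eq_add_of_le hT
    have h1 := hK.off_window i₀ I hI τ (h := h) (fun j => (inv_pos.2 (hX j)).le)
      (fun j hj => by have := hh j hj; rw [inv_mul_eq_div]; exact this) W r n
    rw [he, Expt.E_rep_add] at h1
    have h2 : ((slot ch).rep (8 * T)).E (fun σ => oc d V pen (o i₀) σ (o i₀)) ≤
        ((slot ch).rep (8 * T)).E fun l => ((slot ch).rep e).E fun l' =>
          oc d V pen (o i₀) (l ++ l') (o i₀) := by
      refine Expt.E_mono _ fun l => ?_
      rw [← Expt.E_const ((slot ch).rep e) (oc d V pen (o i₀) l (o i₀))]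
      refine Expt.E_mono _ fun l' => ?_
      exact oc_prefix_le hd hp.1 (hsub _ (ho _)) l l'
    refine h2.trans (h1.trans ?_)
    have e1 : (X i₀)⁻¹ * W / 2 = W / X i₀ / 2 := by ring
    have e2 : (X i₀)⁻¹ * r / 2 = r / X i₀ / 2 := by ring
    rw [e1, e2]
    refine (mul_le_mul_of_nonneg_left hle hΔ.le).trans (le_of_eq ?_)
    push_cast
    rw [mul_div_mul_comm]
    ring

end NodeAdm

/-! ### Choosing the parameters of a node -/

section Plan

variable {ι : Type}

theorem Plan.mono {X : ι → ℝ} {Y Y' : ℝ} (h : Plan X Y) (h0 : 0 < Y') (hY : Y' ≤ Y) :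
    Plan X Y' := by
  obtain ⟨i₀, h⟩ := h
  refine ⟨i₀, fun T => ?_⟩
  obtain ⟨n, W, r, I, τ, h, h1, h2, h3, h4⟩ := h T
  refine ⟨n, W, r, I, τ, h, h1, h2, h3, h4.trans ?_⟩
  gcongr

theorem plan_of_four_pow_le [Fintype ι] {X : ι → ℝ} {i₀ : ι} (hX : 1 / 2 ≤ X i₀) {W : ℕ} (hW : 1 ≤ W)
    (hN : 4 ^ W ≤ (Finset.univ.erase i₀).card) : Plan X (W / 10) := by
  refine ⟨i₀, fun T => ⟨T / W + 1, W, 0, Finset.univ.erase i₀, fun _ => 0, 4, ?_, by simp,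
    fun j _ => by simp, ?_⟩⟩
  · have := Nat.div_add_mod T W
    have := Nat.mod_lt T (by omega : W > 0)
    rw [add_mul, mul_comm]
    omega
  · set N := (Finset.univ.erase i₀).card with hNdef
    have hW' : (1 : ℝ) ≤ W := by exact_mod_cast hW
    have hp : (0 : ℝ) < (1 / 2) ^ W := by positivity
    have hp1 : ((1 : ℝ) / 2) ^ W ≤ 1 := pow_le_one₀ (by norm_num) (by norm_num)
    have hπ := one_sub_pow_mul_le N hp.le hp1
    have hN' : (4 : ℝ) ^ W ≤ N := by exact_mod_cast hN
    have hNp : (W : ℝ) ≤ N * (1 / 2) ^ W := by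
      have h1 : (4 : ℝ) ^ W * (1 / 2) ^ W = 2 ^ W := by rw [← mul_pow]; norm_num
      have h2 : (W : ℝ) < 2 ^ W := by exact_mod_cast W.lt_two_pow_self
      nlinarith
    have hπ0 : (0 : ℝ) ≤ (1 - (1 / 2) ^ W) ^ N := pow_nonneg (by linarith) N
    rw [Finset.prod_const, binE_lt, binE_zero, ← hNdef]
    set π : ℝ := (1 - (1 / 2) ^ W) ^ N
    have hπW : π * W ≤ 1 := by nlinarith
    have h3 : (W : ℝ) / X i₀ / 2 ≤ W := by
      rw [div_div, div_le_iff₀ (by linarith)]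
      nlinarith
    have h4 : 4 + π * (W / X i₀ / 2 - 4) ≤ 5 := by nlinarith
    have h5 : ((T / W + 1 : ℕ) : ℝ) ≤ T / W + 1 := by
      push_cast
      linarith [@Nat.cast_div_le ℝ _ _ _ T W]
    have h6 : (T : ℝ) / (2 * (W / 10)) = 5 * (T / W) := by field_simp; ring
    have h7 : (0 : ℝ) ≤ (T / W + 1 : ℕ) := by positivity
    rw [h6]
    simp only [Nat.cast_zero, zero_div]
    nlinarith

theorem plan_of_tail {X : ι → ℝ} {i₀ : ι} (hX : 0 < X i₀) {W τ : ℕ} (hW : 1 ≤ W)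
    {I : Finset ι} (hI : i₀ ∉ I) (hτ : ∀ j ∈ I, 4 + τ / X j ≤ W / (2 * X i₀) - 1) {p Y : ℝ}
    (h0 : 0 ≤ p) (hp : p ≤ binE W fun t => if t ≤ τ then 1 else 0) (hY0 : 0 < Y)
    (hY : Y ≤ X i₀ + min 1 (I.card * p) * (X i₀ ^ 2 / W)) : Plan X Y := by
  refine ⟨i₀, fun T => ⟨T / W, W, T % W, I, fun _ => τ, W / (2 * X i₀) - 1, ?_, hI, hτ, ?_⟩⟩
  · rw [Nat.div_add_mod']
  · rw [Finset.prod_const]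
    set N := I.card
    have hπ1 : (binE W fun t => if τ < t then (1 : ℝ) else 0) ≤ 1 - p := by
      rw [binE_lt]; linarith
    have hπ0 := binE_lt_nonneg W τ
    set b := binE W fun t => if τ < t then (1 : ℝ) else 0
    have hp1 : p ≤ 1 := by linarith
    have hb : b ^ N ≤ (1 - p) ^ N := pow_le_pow_left₀ hπ0 hπ1 N
    have h1 := one_sub_pow_mul_le N h0 hp1
    have hNp : (0 : ℝ) ≤ N * p := by positivity
    set P : ℝ := min 1 (N * p) with hP
    have hP0 : 0 ≤ P := le_min zero_le_one hNp
    have hP1 : P ≤ 1 := min_le_left _ _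
    have hPN : P ≤ N * p := min_le_right _ _
    have hW0 : (0 : ℝ) < W := by exact_mod_cast hW
    have hbP : b ^ N ≤ 1 - P / 2 := by
      have hq : 0 ≤ (1 - p) ^ N := pow_nonneg (by linarith) N
      have h2 : (1 - p) ^ N * (1 + P) ≤ 1 := by nlinarith
      have h3 : 1 ≤ (1 - P / 2) * (1 + P) := by nlinarith
      have h4 : (1 - p) ^ N ≤ 1 - P / 2 := le_of_mul_le_mul_right (h2.trans h3) (by linarith)
      exact hb.trans h4
    have hn : (T : ℝ) = (T / W : ℕ) * W + (T % W : ℕ) := by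
      exact_mod_cast (Nat.div_add_mod' T W).symm
    have hr : ((T % W : ℕ) : ℝ) ≤ W := by exact_mod_cast (Nat.mod_lt T hW).le
    have hn0 : (0 : ℝ) ≤ (T / W : ℕ) := by positivity
    set n : ℝ := ((T / W : ℕ) : ℝ)
    set r : ℝ := ((T % W : ℕ) : ℝ)
    have hT : (0 : ℝ) ≤ T := by positivity
    have e1 : (W : ℝ) / X i₀ / 2 = W / (2 * X i₀) := by field_simp
    rw [e1]
    have hY2 : 1 / (2 * X i₀) - P / 2 / W ≤ 1 / (2 * Y) := by
      rcases le_or_gt (1 / (2 * X i₀) - P / 2 / W) 0 with h | h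
      · exact h.trans (by positivity)
      · rw [le_div_iff₀ (by positivity)]
        have e2 : (1 / (2 * X i₀) - P / 2 / W) * (2 * (X i₀ + P * (X i₀ ^ 2 / W)))
            = 1 - (P * X i₀ / W) ^ 2 := by field_simp; ring
        nlinarith [sq_nonneg (P * X i₀ / W)]
    have h8 := mul_le_mul_of_nonneg_left hY2 hT
    have e3 : (T : ℝ) * (1 / (2 * Y)) = T / (2 * Y) := by ring
    have e4 : (T : ℝ) * (1 / (2 * X i₀) - P / 2 / W)
        = n * (W / (2 * X i₀)) + r / X i₀ / 2 - n * (P / 2) - r / W * (P / 2) := by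
      rw [hn]; field_simp; ring
    have h9 : r / W * (P / 2) ≤ 1 := by
      have : r / W ≤ 1 := (div_le_one hW0).2 hr
      have : 0 ≤ r / W := by positivity
      nlinarith
    have h10 : n * (W / (2 * X i₀) - 1 + b ^ N * (W / (2 * X i₀) - (W / (2 * X i₀) - 1)))
        ≤ n * (W / (2 * X i₀) - P / 2) := mul_le_mul_of_nonneg_left (by linarith) hn0
    linarith

theorem plan_of_count [Fintype ι] {X : ι → ℝ} {i₀ : ι} (hX : ∀ i, 1 / 2 ≤ X i) (j : ℕ) {Y : ℝ} (hY0 : 0 < Y)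
    (hY : Y ≤ X i₀ + min 1 ((((Finset.univ.erase i₀).filter fun i => X i₀ - j ≤ X i).card : ℝ)
      * ((1 / 10) ^ 321) ^ (j + 1)) * (min (j + 1 : ℝ) (X i₀) / 12)) : Plan X Y := by
  set I := (Finset.univ.erase i₀).filter fun i => X i₀ - j ≤ X i
  have hI : i₀ ∉ I := by simp [I]
  set x := X i₀
  have hx : 1 / 2 ≤ x := hX i₀
  have hmin : ∀ p : ℝ, ((1 / 10) ^ 321) ^ (j + 1) ≤ p → ∀ z : ℝ, min (j + 1 : ℝ) x / 12 ≤ z →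
      Y ≤ x + min 1 (I.card * p) * z := fun p hp z hz => by
    refine hY.trans (add_le_add_right (mul_le_mul (min_le_min_left _ ?_) hz ?_ ?_) _)
    · exact mul_le_mul_of_nonneg_left hp (by positivity)
    · exact div_nonneg (le_min (by positivity) (by linarith)) (by norm_num)
    · exact le_min zero_le_one (mul_nonneg (by positivity) (le_trans (by positivity) hp))
  rw [← pow_mul] at hmin
  rcases le_or_gt (4 * (j + 1 : ℝ)) x with hj | hj
  · have hj0 : (0 : ℝ) ≤ j := by positivity
    set k := ⌊x / (4 * (j + 1 : ℝ))⌋₊ with hk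
    have hk1 : 1 ≤ k := Nat.le_floor (by rw [Nat.cast_one, le_div_iff₀ (by linarith)]; linarith)
    have hk1' : (1 : ℝ) ≤ k := by exact_mod_cast hk1
    have hkle : (k : ℝ) * (4 * (j + 1)) ≤ x :=
      (le_div_iff₀ (by linarith)).1 (Nat.floor_le (by positivity))
    have hkge : x ≤ k * (8 * (j + 1)) := by
      have := (div_lt_iff₀ (by linarith)).1 (Nat.lt_floor_add_one (x / (4 * (j + 1 : ℝ))))
      rw [← hk] at this
      nlinarith
    set N := ⌈40 * x / k⌉₊ with hN
    have hN1 : 40 * x ≤ N * k := (div_le_iff₀ (by linarith)).1 (Nat.le_ceil _)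
    have hN2 : (N : ℝ) < 40 * x / k + 1 := Nat.ceil_lt_add_one (by positivity)
    have hN3 : (N : ℝ) * k ≤ 40 * x + k := by
      have h1 := mul_le_mul_of_nonneg_right hN2.le (by linarith : (0 : ℝ) ≤ k)
      rwa [add_mul, div_mul_cancel₀ _ (by linarith), one_mul] at h1
    have hN4 : N ≤ 321 * (j + 1) := by
      have h1 : 40 * x / k ≤ 320 * (j + 1) := by
        rw [div_le_iff₀ (by linarith)]; nlinarith
      have h2 : (N : ℝ) < 320 * (j + 1) + 1 := by linarith
      have h3 : N < 320 * (j + 1) + 1 := by exact_mod_cast h2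
      omega
    have hkx : (k : ℝ) ≤ x / 4 := by nlinarith
    have hN0 : 1 ≤ N := by
      rcases Nat.eq_zero_or_pos N with h | h
      · rw [h] at hN1; norm_num at hN1; linarith
      · exact h
    have hB : (0 : ℝ) ≤ N * ((k : ℝ) ^ 2 / 2 - k / 4) := mul_nonneg (by positivity) (by nlinarith)
    set τ := ⌊(N * ((k : ℝ) ^ 2 / 2 - k / 4) : ℝ)⌋₊
    have hτ := Nat.floor_le hB
    have hcast : ((N * k ^ 2 : ℕ) : ℝ) = N * k * k := by push_cast; ring
    refine plan_of_tail (i₀ := i₀) (W := N * k ^ 2) (τ := τ) (p := (1 / 10) ^ N) (by linarith)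
      (Nat.mul_pos hN0 (by positivity)) hI ?_ (by positivity) ?_ hY0 (hmin _ ?_ _ ?_)
    · intro i hi
      have hxi : x - j ≤ X i := (Finset.mem_filter.1 hi).2
      have hWx : 20 ≤ (N * k ^ 2 : ℕ) / (2 * x) := by
        rw [le_div_iff₀ (by linarith), hcast]; nlinarith
      suffices (τ : ℝ) / X i ≤ (N * k ^ 2 : ℕ) / (2 * x) - 5 by linarith
      rw [div_le_iff₀ (by linarith [hX i])]
      have h1 : ((N * k ^ 2 : ℕ) / (2 * x) - 5) * (x - j) ≤
          ((N * k ^ 2 : ℕ) / (2 * x) - 5) * X i :=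
        mul_le_mul_of_nonneg_left hxi (by linarith)
      have h2 : ((N * k ^ 2 : ℕ) / (2 * x) - 5) * (x - j)
          = N * k * k / 2 - 5 * x + 5 * j - N * k * (k * j / (2 * x)) := by
        rw [hcast]; field_simp; ring
      have h3 : (k * j : ℝ) / (2 * x) ≤ 1 / 8 := by
        rw [div_le_iff₀ (by linarith)]; nlinarith
      have h4 : (N * k : ℝ) * (k * j / (2 * x)) ≤ N * k * (1 / 8) :=
        mul_le_mul_of_nonneg_left h3 (by positivity)
      nlinarith
    · refine (binE_tail N k hk1).trans (binE_mono _ fun t => ?_)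
      split_ifs with h1 h2
      · rfl
      · exact absurd (Nat.le_floor h1) h2
      · norm_num
      · rfl
    · exact pow_le_pow_of_le_one (by norm_num) (by norm_num) hN4
    · refine (div_le_div_of_nonneg_right (min_le_left _ _) (by norm_num)).trans ?_
      rw [hcast, le_div_iff₀ (by positivity)]
      have h1 : (N : ℝ) * k * k ≤ 41 * x * k := by
        refine mul_le_mul_of_nonneg_right ?_ (by positivity)
        linarith
      nlinarith
  · set W := ⌈10 * x⌉₊
    have hW1 : 10 * x ≤ W := Nat.le_ceil _
    have hW2 : (W : ℝ) < 10 * x + 1 := Nat.ceil_lt_add_one (by linarith)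
    have hW3 : W < 40 * (j + 1) + 1 := by
      have : (W : ℝ) < 40 * (j + 1) + 1 := by linarith
      exact_mod_cast this
    have hW0 : (0 : ℝ) < W := by linarith
    refine plan_of_tail (i₀ := i₀) (W := W) (τ := 0) (p := (1 / 2) ^ W) (by linarith)
      (by exact_mod_cast hW0) hI ?_ (by positivity) (binE_zero W).ge hY0 (hmin _ ?_ _ ?_)
    · intro i _
      have : 5 ≤ (W : ℝ) / (2 * x) := by rw [le_div_iff₀ (by linarith)]; linarith
      simp only [Nat.cast_zero, zero_div]
      linarith
    · calc ((1 : ℝ) / 10) ^ (321 * (j + 1)) ≤ (1 / 10) ^ W :=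
          pow_le_pow_of_le_one (by norm_num) (by norm_num) (by omega)
        _ ≤ (1 / 2) ^ W := by gcongr; norm_num
    · refine (div_le_div_of_nonneg_right (min_le_right _ _) (by norm_num)).trans ?_
      rw [le_div_iff₀ hW0]
      nlinarith

end Plan

/-! ### Exponential superadditivity of node values -/

section Growth

variable {ι : Type}

theorem half_mul_exp_half_le (y : ℝ) (hy : 0 ≤ y) : y * Real.exp (y / 2) ≤ Real.exp y - 1 := by
  have h1 := Real.self_le_sinh_iff.2 (by linarith : 0 ≤ y / 2)
  rw [Real.sinh_eq] at h1
  have h2 : Real.exp (y / 2) * Real.exp (y / 2) = Real.exp y := by rw [← Real.exp_add]; ring_nf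
  have h3 : Real.exp (-(y / 2)) * Real.exp (y / 2) = 1 := by rw [← Real.exp_add]; simp
  have h4 := (Real.exp_pos (y / 2)).le
  nlinarith

/-- If few numbers of the family `D` are below each integer, then `∑ exp (-a * D i)` is small. -/
theorem sum_exp_neg_le (I : Finset ι) (D : ι → ℝ) (a : ℝ) (ha : 0 ≤ a) (hD : ∀ i ∈ I, 0 ≤ D i)
    (m : ℕ) {A C : ℝ} (hA : 1 ≤ A) (hC : 0 ≤ C) (haA : 2 * A ≤ Real.exp a)
    (hN : ∀ j, m ≤ j → ((I.filter fun i => D i ≤ j).card : ℝ) ≤ C * A ^ (j + 1)) :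
    ∑ i ∈ I, Real.exp (-(a * D i)) ≤ C * (A ^ (m + 1) + 2 * A ^ 2) := by
  set K := ∑ i ∈ I, ⌈D i⌉₊
  have hpt : ∀ i ∈ I, Real.exp (-(a * D i)) ≤ (if D i ≤ m then 1 else 0) +
      ∑ j ∈ Finset.range K, if m ≤ j then
        (if D i ≤ (j + 1 : ℕ) then 1 else 0) * Real.exp (-(a * j)) else 0 := by
    intro i hi
    have hnn : ∀ j ∈ Finset.range K, 0 ≤ if m ≤ j then
        (if D i ≤ (j + 1 : ℕ) then 1 else 0) * Real.exp (-(a * j)) else 0 := fun j _ => by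
      split_ifs <;> positivity
    by_cases hm : D i ≤ m
    · rw [if_pos hm]
      have h1 : Real.exp (-(a * D i)) ≤ 1 :=
        Real.exp_le_one_iff.2 (by nlinarith [hD i hi])
      have h2 := Finset.sum_nonneg hnn
      linarith
    · rw [if_neg hm, zero_add]
      have hlt : m < ⌈D i⌉₊ := Nat.lt_ceil.2 (not_le.1 hm)
      obtain ⟨j, hj⟩ := Nat.exists_eq_add_of_lt hlt
      have hK : ⌈D i⌉₊ ≤ K := Finset.single_le_sum (f := fun i => ⌈D i⌉₊) (by simp) hi
      have hle := Nat.le_ceil (D i)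
      have hgt : ((m + j : ℕ) : ℝ) < D i := Nat.lt_ceil.1 (by omega)
      refine le_trans ?_ (Finset.single_le_sum hnn (Finset.mem_range.2 (by omega : m + j < K)))
      rw [hj] at hle
      rw [if_pos (by omega), if_pos hle, one_mul]
      exact Real.exp_le_exp.2 (neg_le_neg (mul_le_mul_of_nonneg_left hgt.le ha))
  refine (Finset.sum_le_sum hpt).trans ?_
  rw [Finset.sum_add_distrib, Finset.sum_comm, mul_add]
  refine add_le_add ?_ ?_
  · rw [Finset.sum_boole]
    exact hN m le_rfl
  · have hgeom : ∑ j ∈ Finset.range K, C * A ^ 2 * (1 / 2 : ℝ) ^ j ≤ C * (2 * A ^ 2) := by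
      rw [← Finset.mul_sum]
      have h := sum_geometric_two_le K
      have h0 : 0 ≤ C * A ^ 2 := by positivity
      nlinarith
    refine le_trans (Finset.sum_le_sum fun j _ => ?_) hgeom
    split_ifs with hj
    · rw [← Finset.sum_mul, Finset.sum_boole]
      have h1 := hN (j + 1) (by omega)
      have h2 : A ^ j * Real.exp (-(a * j)) ≤ (1 / 2) ^ j := by
        have e : Real.exp (-(a * j)) = (Real.exp a)⁻¹ ^ j := by
          rw [← Real.exp_neg, ← Real.exp_nat_mul]; ring_nf
        rw [e, ← mul_pow]
        refine pow_le_pow_left₀ (by positivity) ?_ j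
        rw [← div_eq_mul_inv, div_le_iff₀ (Real.exp_pos a)]
        linarith
      calc _ ≤ C * A ^ (j + 1 + 1) * Real.exp (-(a * j)) :=
            mul_le_mul_of_nonneg_right h1 (Real.exp_pos _).le
        _ = C * A ^ 2 * (A ^ j * Real.exp (-(a * j))) := by ring
        _ ≤ _ := mul_le_mul_of_nonneg_left h2 (by positivity)
    · rw [Finset.sum_const_zero]
      positivity

theorem exists_plan_rate : ∃ a : ℝ, 0 < a ∧ ∀ (ι : Type) [Fintype ι] (X : ι → ℝ),
    (∀ i, 1 / 2 ≤ X i) → (∀ i : ι, ∃ j, j ≠ i) → ∀ _ : Nonempty ι,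
      ∃ Y, Plan X Y ∧ 1 / 2 < Y ∧ ∑ i, Real.exp (a * X i) ≤ Real.exp (a * Y) := by
  obtain ⟨A, hA, hcount⟩ : ∃ A : ℝ, 10 ≤ A ∧ ∀ (ι : Type) [Fintype ι] (X : ι → ℝ) (i₀ : ι),
      (∀ i, 1 / 2 ≤ X i) → ∀ (j : ℕ) (Y : ℝ), 0 < Y →
      Y ≤ X i₀ + min 1 ((((Finset.univ.erase i₀).filter fun i => X i₀ - j ≤ X i).card : ℝ)
        / A ^ (j + 1)) * (min (j + 1 : ℝ) (X i₀) / 12) → Plan X Y := by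
    refine ⟨10 ^ 321, le_self_pow₀ (by norm_num) (by norm_num), fun ι _ X i₀ hX j Y h0 hY => 
      plan_of_count (i₀ := i₀) hX j h0 (hY.trans_eq ?_)⟩
    rw [div_eq_mul_inv, one_div, inv_pow, inv_pow]
  refine ⟨160 * A ^ 2, by positivity, fun ι _ X hX hne hι => ?_⟩
  set a := 160 * A ^ 2 with ha
  have ha0 : 16000 ≤ a := by nlinarith
  obtain ⟨i₀, -, hmax⟩ := Finset.exists_max_image Finset.univ X Finset.univ_nonempty
  set x := X i₀ with hx
  have hx2 : 1 / 2 ≤ x := hX i₀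
  set D : ι → ℝ := fun i => x - X i with hD
  have hD0 : ∀ i, 0 ≤ D i := fun i => sub_nonneg.2 (hmax i (Finset.mem_univ i))
  set I := (Finset.univ : Finset ι).erase i₀ with hI
  set s := ∑ i ∈ I, Real.exp (-(a * D i)) with hs
  have hI0 : I.Nonempty := by
    obtain ⟨j, hj⟩ := hne i₀
    exact ⟨j, by simp [hI, hj]⟩
  have hs0 : 0 < s := Finset.sum_pos (fun i _ => Real.exp_pos _) hI0
  have hsum : ∑ i, Real.exp (a * X i) = Real.exp (a * x) * (1 + s) := by
    rw [← Finset.add_sum_erase _ _ (Finset.mem_univ i₀), mul_add, mul_one, hs, Finset.mul_sum]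
    refine congrArg _ (Finset.sum_congr rfl fun i _ => ?_)
    rw [← Real.exp_add, hD]
    ring_nf
  set g := Real.log (1 + s) / a with hg
  have hag : a * g = Real.log (1 + s) := mul_div_cancel₀ _ (by linarith)
  have hexp : Real.exp (a * g) = 1 + s := by rw [hag, Real.exp_log (by linarith)]
  have hg0 : 0 < g := div_pos (Real.log_pos (by linarith)) (by linarith)
  refine ⟨x + g, ?_, by linarith, by
    rw [hsum, mul_add a x g, Real.exp_add, hexp]⟩
  by_contra hplan
  have hno : ∀ Y, x + g ≤ Y → ¬ Plan X Y := fun Y hY h => hplan (h.mono (by linarith) hY)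
  rcases le_or_gt x (12 * g) with hxg | hxg
  · set W := ⌈130 * g⌉₊
    have hW := Nat.le_ceil (130 * g)
    have hW2 : (W : ℝ) < 130 * g + 1 := Nat.ceil_lt_add_one (by linarith)
    have hW1 : 1 ≤ W := by
      have : (0 : ℝ) < W := by linarith
      exact_mod_cast this
    have hcard : I.card < 4 ^ W := by
      by_contra h
      exact hno (W / 10) (by linarith) (plan_of_four_pow_le (i₀ := i₀) hx2 hW1 (not_lt.1 h))
    have hsI : s ≤ I.card := by
      rw [hs, Finset.cast_card]
      exact Finset.sum_le_sum fun i _ => Real.exp_le_one_iff.2 (by nlinarith [hD0 i])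
    have h1 : 1 + s ≤ 4 ^ W := by
      have : (I.card : ℝ) + 1 ≤ 4 ^ W := by exact_mod_cast hcard
      linarith
    have h2 : (4 : ℝ) ^ W ≤ Real.exp (3 * W) := by
      rw [mul_comm, Real.exp_nat_mul]
      exact pow_le_pow_left₀ (by norm_num) (by linarith [Real.add_one_le_exp 3]) W
    have h3 := Real.exp_le_exp.1 (hexp.le.trans (h1.trans h2))
    nlinarith
  · have hN : ∀ j : ℕ, ⌊12 * g⌋₊ ≤ j →
        ((I.filter fun i => D i ≤ j).card : ℝ) ≤ 24 * g * A ^ (j + 1) := by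
      intro j hj
      have hj' : 12 * g < j + 1 := by
        have := Nat.lt_floor_add_one (12 * g)
        have : (⌊12 * g⌋₊ : ℝ) ≤ j := by exact_mod_cast hj
        linarith
      have hAj : 0 < A ^ (j + 1) := by positivity
      have h := fun h => hno (x + g) le_rfl (hcount ι X i₀ hX j (x + g) (by linarith) h)
      have hset : (I.filter fun i => D i ≤ j) = I.filter fun i => x - j ≤ X i :=
        Finset.filter_congr fun i _ => by
          simp only [hD]; constructor <;> intro h <;> linarith
      rw [hset]
      rw [← hI, ← hx] at h
      set N : ℝ := ((I.filter fun i => x - j ≤ X i).card : ℝ)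
      have hmin : 12 * g < min (j + 1 : ℝ) x := lt_min hj' hxg
      have hmin2 : 1 / 2 ≤ min (j + 1 : ℝ) x :=
        le_min (by have : (0 : ℝ) ≤ j := by positivity
                   linarith) hx2
      by_contra hcon
      refine h (add_le_add_right ?_ _)
      have hNA : 24 * g < N / A ^ (j + 1) := (lt_div_iff₀ hAj).2 (not_le.1 hcon)
      rcases le_total 1 (N / A ^ (j + 1)) with h1 | h1
      · rw [min_eq_left h1]; linarith
      · rw [min_eq_right h1]; nlinarith
    have haA : 2 * A ≤ Real.exp a := by
      have := Real.add_one_le_exp a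
      nlinarith
    have h1 := sum_exp_neg_le I D a (by linarith) (fun i _ => hD0 i) _ (by linarith)
      (by linarith) haA hN
    have h2 : A ^ ⌊12 * g⌋₊ ≤ Real.exp (a * g / 2) := by
      have h3 : A ≤ Real.exp A := by linarith [Real.add_one_le_exp A]
      refine (pow_le_pow_left₀ (by linarith) h3 _).trans ?_
      rw [← Real.exp_nat_mul]
      refine Real.exp_le_exp.2 ?_
      have := Nat.floor_le (by linarith : 0 ≤ 12 * g)
      have h4 : (⌊12 * g⌋₊ : ℝ) * A ≤ 12 * g * A := mul_le_mul_of_nonneg_right this (by linarith)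
      have h5 : 24 * A ≤ a := by nlinarith
      have h6 := mul_le_mul_of_nonneg_left h5 hg0.le
      linarith
    have h3 := half_mul_exp_half_le (a * g) (by positivity)
    have h4 : 1 ≤ Real.exp (a * g / 2) := Real.one_le_exp (by positivity)
    set E := Real.exp (a * g / 2)
    have h5 : A ^ (⌊12 * g⌋₊ + 1) + 2 * A ^ 2 ≤ 3 * A ^ 2 * E := by
      rw [pow_succ]
      have h6 : A ^ ⌊12 * g⌋₊ * A ≤ E * A := mul_le_mul_of_nonneg_right h2 (by linarith)
      have h7 : 0 ≤ A * E * (A - 1) := by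
        have : 0 ≤ A * E := by positivity
        exact mul_nonneg this (by linarith)
      have h8 : 0 ≤ A ^ 2 * (E - 1) := mul_nonneg (by positivity) (by linarith)
      linarith
    have h6 := mul_le_mul_of_nonneg_left h5 (by linarith : 0 ≤ 24 * g)
    have h7 : 24 * g * (3 * A ^ 2 * E) < a * g * E := by
      rw [ha]
      have : 0 < g * A ^ 2 * E := by positivity
      linarith
    linarith

end Growth

/-! ### Hierarchical decomposition of a finite metric space -/

section Hierarchy

variable {M : Type u} {d : M → M → ℝ}

/-- `S` has value `X` at all scales `δ * 4 ^ i` with `k ≤ i`. -/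
def AdmFrom (d : M → M → ℝ) (δ : ℝ) (k : ℕ) (S : Finset M) (X : ℝ) : Prop :=
  1 / 2 ≤ X ∧ (X = 1 / 2 ∨ ∃ x ∈ S, ∃ y ∈ S, x ≠ y) ∧ ∀ i, k ≤ i → Adm d S (δ * 4 ^ i) X

theorem AdmFrom.mono {δ X : ℝ} {k k' : ℕ} {S : Finset M} (h : AdmFrom d δ k S X) (hk : k ≤ k') :
    AdmFrom d δ k' S X :=
  ⟨h.1, h.2.1, fun i hi => h.2.2 i (hk.trans hi)⟩

theorem AdmFrom.nonempty {δ X : ℝ} {k : ℕ} {S : Finset M} (h : AdmFrom d δ k S X) :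
    S.Nonempty := (h.2.2 k le_rfl).nonempty

theorem admFrom_singleton (hd : IsMetric d) {δ : ℝ} (hδ : 0 ≤ δ) (k : ℕ) (p : M) :
    AdmFrom d δ k {p} (1 / 2) :=
  ⟨le_rfl, Or.inl rfl, fun _ _ => adm_singleton hd p (by positivity)⟩

theorem admFrom_of_adm {δ X : ℝ} (hδ : 0 ≤ δ) {k : ℕ} {S : Finset M} (hX : 1 / 2 ≤ X)
    (hS : ∀ x ∈ S, ∃ y ∈ S, x ≠ y ∧ d x y ≤ δ * 4 ^ k) (h : Adm d S (δ * 4 ^ k) X) :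
    AdmFrom d δ k S X := by
  refine ⟨hX, Or.inr ?_, fun i hi => ?_⟩
  · obtain ⟨x, hx⟩ := h.nonempty
    obtain ⟨y, hy, hxy, -⟩ := hS x hx
    exact ⟨x, hx, y, hy, hxy⟩
  · induction i, hi using Nat.le_induction with
    | base => exact h
    | succ i hi ih =>
      have := ih.raise (by positivity) fun x hx => by
        obtain ⟨y, hy, hxy, hle⟩ := hS x hx
        exact ⟨y, hy, hxy, hle.trans (by gcongr; norm_num)⟩
      convert this using 1
      ring

/-- If small balls of `S` have at most `μ` points, then `S` contains a subset of value `X` with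
`exp (a * (X - 1 / 2)) ≥ S.card / √μ`. -/
def Ramsey (d : M → M → ℝ) (δ a : ℝ) (k : ℕ) : Prop :=
  ∀ (S : Finset M) (μ : ℝ), S.Nonempty → (∀ x ∈ S, ∀ y ∈ S, d x y ≤ δ * 4 ^ k) →
    (∀ x ∈ S, ((S.filter fun y => d x y ≤ δ * 4 ^ k / 4).card : ℝ) ≤ μ) →
    ∃ S' ⊆ S, ∃ X, AdmFrom d δ (k + 1) S' X ∧
      (S.card : ℝ) ≤ Real.sqrt μ * Real.exp (a * (X - 1 / 2))

theorem exists_growth_radius {b₀ b₁ b₂ μ : ℝ} (h0 : 0 < b₀) (h1 : 0 < b₁) (h2 : b₂ ≤ μ) :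
    b₁ * Real.sqrt b₀ ≤ Real.sqrt μ * b₀ ∨ b₂ * Real.sqrt b₀ ≤ Real.sqrt μ * b₁ := by
  rcases le_or_gt μ 0 with hμ | hμ
  · right
    have := Real.sqrt_nonneg b₀
    have := Real.sqrt_nonneg μ
    nlinarith
  by_contra! h
  obtain ⟨ha, hb⟩ := h
  have e0 := Real.mul_self_sqrt h0.le
  have eμ := Real.mul_self_sqrt hμ.le
  have p0 := Real.sqrt_pos.2 h0
  have pμ := Real.sqrt_pos.2 hμ
  set s := Real.sqrt b₀
  set m := Real.sqrt μ
  have ha' : m * s < b₁ := by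
    rw [← e0, ← mul_assoc] at ha
    exact lt_of_mul_lt_mul_right ha p0.le
  have h3 : m * (m * s) < m * b₁ := mul_lt_mul_of_pos_left ha' pμ
  have h4 : b₂ * s ≤ μ * s := mul_le_mul_of_nonneg_right h2 p0.le
  rw [← mul_assoc, eμ] at h3
  linarith

theorem peel (hd : IsMetric d) {δ a : ℝ} (hδ : 0 < δ) {k : ℕ} (hk : Ramsey d δ a k) {μ : ℝ}
    (m : ℕ) (R : Finset M) (hm : R.card = m)
    (hμ : ∀ x ∈ R, ((R.filter fun y => d x y ≤ δ * 4 ^ (k + 1) / 4).card : ℝ) ≤ μ) :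
    ∃ (ι : Type) (_ : Fintype ι) (Sf : ι → Finset M) (X : ι → ℝ),
      (∀ i, Sf i ⊆ R) ∧ (∀ i, AdmFrom d δ (k + 1) (Sf i) (X i)) ∧
      (∀ i j, i ≠ j → ∀ x ∈ Sf i, ∀ y ∈ Sf j, δ * 4 ^ (k + 1) / 16 ≤ d x y) ∧
      (R.card : ℝ) ≤ Real.sqrt μ * ∑ i, Real.exp (a * (X i - 1 / 2)) := by
  induction m using Nat.strong_induction_on generalizing R with
  | _ m ih =>
  rcases R.eq_empty_or_nonempty with rfl | hR
  · exact ⟨Fin 0, inferInstance, fun i => i.elim0, fun i => i.elim0, fun i => i.elim0,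
      fun i => i.elim0, fun i => i.elim0, by simp⟩
  set Δ := δ * 4 ^ (k + 1) with hΔ
  have hΔ0 : 0 < Δ := by positivity
  have hΔ4 : δ * 4 ^ k = Δ / 4 := by rw [hΔ, pow_succ]; ring
  obtain ⟨x, hx, hmax⟩ := Finset.exists_max_image R
    (fun x => (R.filter fun y => d x y ≤ Δ / 16).card) hR
  set b : ℝ → Finset M := fun r => R.filter fun y => d x y ≤ r with hb
  have hxb : ∀ r, 0 ≤ r → x ∈ b r := fun r hr =>
    Finset.mem_filter.2 ⟨hx, (hd.self x).trans_le hr⟩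
  have hpos : ∀ r, 0 ≤ r → (0 : ℝ) < (b r).card := fun r hr => by
    exact_mod_cast Finset.card_pos.2 ⟨x, hxb r hr⟩
  have hb0 := hpos (Δ / 16) (by positivity)
  obtain ⟨r, hr1, hr2, hrb⟩ : ∃ r, Δ / 16 ≤ r ∧ r ≤ Δ / 8 ∧
      ((b (2 * r)).card : ℝ) * Real.sqrt (b (Δ / 16)).card ≤ Real.sqrt μ * (b r).card := by
    rcases exists_growth_radius hb0 (hpos (Δ / 8) (by positivity)) (hμ x hx) with h | h
    · exact ⟨Δ / 16, le_rfl, by linarith, by rwa [show 2 * (Δ / 16) = Δ / 8 by ring]⟩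
    · exact ⟨Δ / 8, by linarith, le_rfl, by rwa [show 2 * (Δ / 8) = Δ / 4 by ring]⟩
  obtain ⟨S', hS', X', hX', hcard⟩ := hk (b r) (b (Δ / 16)).card ⟨x, hxb r (by linarith)⟩
    (fun y hy z hz => by
      have h1 := (Finset.mem_filter.1 hy).2
      have h2 := (Finset.mem_filter.1 hz).2
      have h3 := hd.tri y x z
      rw [hd.comm y x] at h3
      rw [hΔ4]
      linarith)
    (fun y hy => by
      have h1 := hmax y (Finset.mem_filter.1 hy).1
      rw [hΔ4, show Δ / 4 / 4 = Δ / 16 by ring]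
      refine le_trans ?_ (Nat.cast_le.2 h1)
      exact_mod_cast Finset.card_le_card
        (Finset.filter_subset_filter _ (Finset.filter_subset _ R)))
  have hsub : b (2 * r) ⊆ R := Finset.filter_subset _ _
  have hlt : (R \ b (2 * r)).card < m := by
    rw [← hm]
    exact Finset.card_lt_card (Finset.sdiff_ssubset hsub ⟨x, hxb _ (by linarith)⟩)
  obtain ⟨ι, hι, Sf, X, h1, h2, h3, h4⟩ := ih _ hlt (R \ b (2 * r)) rfl fun y hy =>
    le_trans (Nat.cast_le.2 (Finset.card_le_card
      (Finset.filter_subset_filter _ Finset.sdiff_subset))) (hμ y (Finset.mem_sdiff.1 hy).1)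
  have hsep : ∀ i, ∀ y ∈ S', ∀ z ∈ Sf i, Δ / 16 ≤ d y z := fun i y hy z hz => by
    have hy' := (Finset.mem_filter.1 (hS' hy)).2
    obtain ⟨hzR, hzb⟩ := Finset.mem_sdiff.1 (h1 i hz)
    have hz' : 2 * r < d x z := by
      by_contra h
      exact hzb (Finset.mem_filter.2 ⟨hzR, not_lt.1 h⟩)
    linarith [hd.tri x y z]
  refine ⟨Option ι, inferInstance, fun i => i.elim S' Sf, fun i => i.elim X' X, ?_, ?_, ?_, ?_⟩
  · rintro (_ | i)
    · exact hS'.trans (Finset.filter_subset _ _)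
    · exact (h1 i).trans Finset.sdiff_subset
  · rintro (_ | i)
    exacts [hX', h2 i]
  · rintro (_ | i) (_ | j) hij y hy z hz
    · exact absurd rfl hij
    · exact hsep j y hy z hz
    · rw [hd.comm]
      exact hsep i z hz y hy
    · exact h3 i j (fun h => hij (congrArg some h)) y hy z hz
  · rw [Fintype.sum_option, mul_add]
    have hc : (R.card : ℝ) = (b (2 * r)).card + (R \ b (2 * r)).card := by
      rw [Finset.card_sdiff_of_subset hsub, Nat.cast_sub (Finset.card_le_card hsub)]
      ring
    rw [hc]
    refine add_le_add ?_ h4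
    have hs0 : 0 < Real.sqrt (b (Δ / 16)).card := Real.sqrt_pos.2 hb0
    refine le_of_mul_le_mul_right (hrb.trans ?_) hs0
    have := mul_le_mul_of_nonneg_left hcard (Real.sqrt_nonneg μ)
    simp only [Option.elim]
    linarith

theorem ramsey (hd : IsMetric d) {δ a : ℝ} (hδ : 0 < δ) (hδd : ∀ x y, d x y ≤ δ → x = y)
    (hplan : ∀ (ι : Type) [Fintype ι] (X : ι → ℝ),
      (∀ i, 1 / 2 ≤ X i) → (∀ i : ι, ∃ j, j ≠ i) → ∀ _ : Nonempty ι,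
        ∃ Y, Plan X Y ∧ 1 / 2 < Y ∧ ∑ i, Real.exp (a * X i) ≤ Real.exp (a * Y)) (k : ℕ) :
    Ramsey d δ a k := by
  induction k with
  | zero =>
    rintro S μ ⟨x, hx⟩ hdiam hμ
    have hS : S = {x} := Finset.eq_singleton_iff_unique_mem.2 ⟨hx, fun y hy =>
      hδd y x (by simpa using hdiam y hy x hx)⟩
    refine ⟨S, subset_rfl, 1 / 2, hS ▸ admFrom_singleton hd hδ.le _ x, ?_⟩
    have h1 : (1 : ℝ) ≤ μ := by
      refine le_trans ?_ (hμ x hx)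
      exact_mod_cast Finset.card_pos.2 ⟨x, Finset.mem_filter.2 ⟨hx, by
        rw [hd.self]; positivity⟩⟩
    rw [hS]
    simpa using h1
  | succ k ih =>
    rintro S μ hS hdiam hμ
    obtain ⟨ι, _, Sf, X, h1, h2, h3, h4⟩ := peel hd hδ ih S.card S rfl hμ
    have hne : Nonempty ι := by
      by_contra h
      rw [not_nonempty_iff] at h
      rw [Finset.univ_eq_empty, Finset.sum_empty, mul_zero] at h4
      have : (0 : ℝ) < S.card := by exact_mod_cast hS.card_pos
      linarith
    by_cases hι : ∀ i : ι, ∃ j, j ≠ i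
    · obtain ⟨Y, hY, hY2, hsum⟩ := hplan ι X (fun i => (h2 i).1) hι hne
      have hVS : (Finset.univ.biUnion Sf) ⊆ S := Finset.biUnion_subset.2 fun i _ => h1 i
      have hΔ : 0 < δ * 4 ^ (k + 1) := by positivity
      have hadm : Adm d (Finset.univ.biUnion Sf) (δ * 4 ^ (k + 1 + 1)) Y := by
        rw [pow_succ, ← mul_assoc, mul_comm _ 4]
        exact adm_node hd hΔ hι (by simp) h3
          (fun x hx y hy => hdiam x (hVS hx) y (hVS hy)) (fun i => by linarith [(h2 i).1])
          (fun i => (h2 i).2.2 _ le_rfl) hY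
      refine ⟨_, hVS, Y, admFrom_of_adm hδ.le hY2.le (fun x hx => ?_) hadm, h4.trans ?_⟩
      · obtain ⟨i, -, hi⟩ := Finset.mem_biUnion.1 hx
        obtain ⟨j, hj⟩ := hι i
        obtain ⟨y, hy⟩ := (h2 j).nonempty
        have hy' := Finset.mem_biUnion.2 ⟨j, Finset.mem_univ j, hy⟩
        refine ⟨y, hy', fun h => ?_, (hdiam x (hVS hx) y (hVS hy')).trans ?_⟩
        · have := h3 i j hj.symm x hi y hy
          rw [h, hd.self] at this
          linarith
        · gcongr
          · norm_num
          · omega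
      · refine mul_le_mul_of_nonneg_left ?_ (Real.sqrt_nonneg μ)
        have e : ∀ x, Real.exp (a * (x - 1 / 2)) = Real.exp (-(a / 2)) * Real.exp (a * x) :=
          fun x => by rw [← Real.exp_add]; ring_nf
        simp only [e, ← Finset.mul_sum]
        exact mul_le_mul_of_nonneg_left hsum (Real.exp_pos _).le
    · push Not at hι
      obtain ⟨i, hi⟩ := hι
      have hu : (Finset.univ : Finset ι) = {i} :=
        Finset.eq_singleton_iff_unique_mem.2 ⟨Finset.mem_univ i, fun j _ => hi j⟩
      rw [hu, Finset.sum_singleton] at h4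
      exact ⟨Sf i, h1 i, X i, (h2 i).mono (by omega), h4⟩

/-- Every finite metric space with `n ≥ 2` points contains a subset, with at least two points,
whose value is at least logarithmic in `n`. -/
theorem exists_adm_log : ∃ a : ℝ, 0 < a ∧ ∀ (M : Type u) (d : M → M → ℝ), Finite M → IsMetric d →
    2 ≤ Nat.card M → ∃ (S : Finset M) (Δ X : ℝ), 0 < Δ ∧ (∃ x ∈ S, ∃ y ∈ S, x ≠ y) ∧
      (∀ x ∈ S, ∀ y ∈ S, d x y ≤ Δ) ∧ Adm d S Δ X ∧ 0 < X ∧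
      Real.log (Nat.card M) / (2 * a) ≤ X := by
  obtain ⟨a, ha, hplan⟩ := exists_plan_rate
  refine ⟨a, ha, fun M d _ hd hn => ?_⟩
  have : Fintype M := Fintype.ofFinite M
  rw [Nat.card_eq_fintype_card] at hn ⊢
  have hne : Nontrivial M := Fintype.one_lt_card_iff_nontrivial.1 hn
  obtain ⟨δ, hδ, hδd⟩ : ∃ δ, 0 < δ ∧ ∀ x y, d x y ≤ δ → x = y := by
    obtain ⟨x₀, y₀, h₀⟩ := hne
    obtain ⟨p, hp, hmin⟩ := Finset.exists_min_image
      (Finset.univ.filter fun p : M × M => p.1 ≠ p.2) (fun p => d p.1 p.2)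
      ⟨(x₀, y₀), by simpa using h₀⟩
    have hpos := hd.pos (Finset.mem_filter.1 hp).2
    refine ⟨d p.1 p.2 / 2, by linarith, fun x y h => ?_⟩
    by_contra hxy
    have := hmin (x, y) (by simpa using hxy)
    simp only at this
    linarith
  obtain ⟨k, hk⟩ : ∃ k : ℕ, ∀ x y, d x y ≤ δ * 4 ^ k := by
    obtain ⟨p, -, hmax⟩ := Finset.exists_max_image (Finset.univ : Finset (M × M))
      (fun p => d p.1 p.2) Finset.univ_nonempty
    obtain ⟨k, hk⟩ := pow_unbounded_of_one_lt (d p.1 p.2 / δ) (by norm_num : (1 : ℝ) < 4)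
    refine ⟨k, fun x y => (hmax (x, y) (Finset.mem_univ _)).trans ?_⟩
    rw [div_lt_iff₀ hδ] at hk
    linarith
  obtain ⟨S, -, X, hX, hcard⟩ := ramsey hd hδ hδd hplan k Finset.univ (Fintype.card M)
    Finset.univ_nonempty (fun x _ y _ => hk x y) fun x _ => by
      exact_mod_cast Finset.card_le_univ _
  rw [Finset.card_univ] at hcard
  have hn1 : (1 : ℝ) < Fintype.card M := by exact_mod_cast hn
  have hsq := Real.mul_self_sqrt (by linarith : (0 : ℝ) ≤ Fintype.card M)
  have hs0 := Real.sqrt_pos.2 (by linarith : (0 : ℝ) < Fintype.card M)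
  have h1 : Real.sqrt (Fintype.card M) ≤ Real.exp (a * (X - 1 / 2)) := by
    rw [← hsq, Real.sqrt_mul_self hs0.le] at hcard
    exact le_of_mul_le_mul_left hcard hs0
  have h2 := (Real.log_le_iff_le_exp hs0).2 h1
  rw [Real.log_sqrt (by linarith)] at h2
  have hlog := Real.log_pos hn1
  have hX2 : 1 / 2 < X := by nlinarith
  refine ⟨S, δ * 4 ^ (k + 1), X, by positivity, ?_, fun x _ y _ => (hk x y).trans ?_,
    hX.2.2 _ le_rfl, by linarith, ?_⟩
  · rcases hX.2.1 with h | h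
    · linarith
    · exact h
  · gcongr
    · norm_num
    · omega
  · rw [div_le_iff₀ (by linarith)]
    nlinarith

end Hierarchy

/-! ### From blocked points to request sequences -/

section Requests

variable {M : Type u} {d : M → M → ℝ}

/-- There is an offline solution of cost `c` for the request sequence. -/
def Solves (d : M → M → ℝ) : M → List (Finset M) → ℝ → Prop
  | _, [], c => c = 0
  | s, r :: σ, c => ∃ y ∈ r, ∃ c', Solves d y σ c' ∧ c = d s y + c'

theorem solves_iff (s : M) (σ : List (Finset M)) (c : ℝ) : Solves d s σ c ↔
    ∃ x : ℕ → M, MssServes s σ x ∧ c = ∑ t ∈ Finset.range σ.length, d (x t) (x (t + 1)) := by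
  induction σ generalizing s c with
  | nil =>
    simp only [Solves, List.length_nil, Finset.range_zero, Finset.sum_empty]
    refine ⟨fun h => ⟨fun _ => s, ⟨rfl, fun t ht => absurd ht (by simp)⟩, h⟩, ?_⟩
    rintro ⟨_, -, h⟩
    exact h
  | cons r σ ih =>
    simp only [Solves, ih]
    constructor
    · rintro ⟨y, hy, c', ⟨x, ⟨hx0, hx⟩, rfl⟩, rfl⟩
      refine ⟨fun t => Nat.casesOn t s x, ⟨rfl, ?_⟩, ?_⟩
      · rintro (_ | t) ht
        · simpa [hx0] using hy
        · exact hx t (by simpa using ht)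
      · rw [List.length_cons, Finset.sum_range_succ', add_comm]
        simp [hx0]
    · rintro ⟨x, ⟨hx0, hx⟩, rfl⟩
      refine ⟨x 1, hx 0 (by simp), _, ⟨fun t => x (t + 1), ⟨rfl, fun t ht => ?_⟩, rfl⟩, ?_⟩
      · exact hx (t + 1) (by simpa using ht)
      · rw [List.length_cons, Finset.sum_range_succ', add_comm, hx0]

theorem mssOpt_eq (s : M) (σ : List (Finset M)) : mssOpt d s σ = sInf {c | Solves d s σ c} := by
  simp only [mssOpt, solves_iff]

theorem Solves.nonneg (hd : IsMetric d) {s : M} {σ : List (Finset M)} {c : ℝ}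
    (h : Solves d s σ c) : 0 ≤ c := by
  induction σ generalizing s c with
  | nil => exact h.ge
  | cons r σ ih =>
    obtain ⟨y, -, c', h', rfl⟩ := h
    exact add_nonneg (hd.nonneg _ _) (ih h')

theorem Solves.suffix (hd : IsMetric d) {s : M} {σ σ' : List (Finset M)} {c : ℝ}
    (h : Solves d s (σ ++ σ') c) : ∃ y, ∃ c' ≤ c, Solves d y σ' c' := by
  induction σ generalizing s c with
  | nil => exact ⟨s, c, le_rfl, h⟩
  | cons r σ ih =>
    obtain ⟨y, -, c', h', rfl⟩ := h
    obtain ⟨z, c'', hle, h''⟩ := ih h'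
    exact ⟨z, c'', hle.trans (le_add_of_nonneg_left (hd.nonneg _ _)), h''⟩

theorem mssOpt_le (hd : IsMetric d) {s : M} {σ : List (Finset M)} {c : ℝ}
    (h : Solves d s σ c) : mssOpt d s σ ≤ c := by
  rw [mssOpt_eq]
  exact csInf_le ⟨0, fun _ h => h.nonneg hd⟩ h

/-- Alternating requests of the points `p` and `q`. -/
def alternate (p q : M) : ℕ → List (Finset M)
  | 0 => []
  | J + 1 => {p} :: alternate q p J

theorem mem_alternate {p q : M} {J : ℕ} {r : Finset M} (h : r ∈ alternate p q J) :
    r = {p} ∨ r = {q} := by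
  induction J generalizing p q with
  | zero => simp [alternate] at h
  | succ J ih =>
    rcases List.mem_cons.1 h with h | h
    · exact Or.inl h
    · exact (ih h).symm

theorem exists_solves_alternate {S : Finset M} {Δ : ℝ} (hΔ : ∀ x ∈ S, ∀ y ∈ S, d x y ≤ Δ)
    {p q z : M} (hp : p ∈ S) (hq : q ∈ S) (hz : z ∈ S) (J : ℕ) :
    ∃ c ≤ J * Δ, Solves d z (alternate p q J) c := by
  induction J generalizing p q z with
  | zero => exact ⟨0, by simp, rfl⟩
  | succ J ih =>
    obtain ⟨c, hc, h⟩ := ih hq hp hp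
    refine ⟨d z p + c, ?_, p, by simp, c, h, rfl⟩
    have := hΔ z hz p hp
    push_cast
    linarith

theorem Solves.le_alternate (hd : IsMetric d) {p q : M} {J : ℕ} {c : ℝ}
    (h : Solves d p (alternate q p J) c) : J * d p q ≤ c := by
  induction J generalizing p q c with
  | zero => rw [show c = 0 from h]; simp
  | succ J ih =>
    obtain ⟨y, hy, c', h', rfl⟩ := h
    rw [Finset.mem_singleton.1 hy] at h' ⊢
    have := ih h'
    rw [hd.comm q p] at this
    push_cast
    linarith

theorem exists_solves_blocked (hd : IsMetric d) {S : Finset M} {pen : M → ℝ}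
    (hpen : ∀ x ∈ S, ∃ y ∈ S, y ≠ x ∧ 2 * d x y ≤ pen x) {σ : List (Finset M)} {K : ℝ}
    (hK : ∀ z ∈ S, ∃ c ≤ K, Solves d z σ c) (y : M) (l : List M) {x : M} (hx : x ∈ S) :
    ∃ c ≤ oc d S pen x l y + K, Solves d x (l.map (fun p => S.erase p) ++ σ) c := by
  induction l generalizing x with
  | nil =>
    obtain ⟨c, hc, h⟩ := hK x hx
    exact ⟨c, hc.trans (le_add_of_nonneg_left (hd.nonneg x y)), h⟩
  | cons p l ih =>
    obtain ⟨z, hz, e⟩ := exists_oc_cons (d := d) ⟨x, hx⟩ pen x p l y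
    rw [e]
    by_cases hzp : z = p
    · obtain ⟨w, hw, hwz, hle⟩ := hpen z hz
      obtain ⟨c, hc, h⟩ := ih hw
      refine ⟨d x w + c, ?_, w, Finset.mem_erase.2 ⟨hzp ▸ hwz, hw⟩, c, h, rfl⟩
      rw [if_pos hzp, ← hzp]
      have h1 := oc_move hd ⟨x, hx⟩ pen w z l y
      have h2 := hd.tri x z w
      have h3 := hd.comm z w
      linarith
    · obtain ⟨c, hc, h⟩ := ih hz
      refine ⟨d x z + c, ?_, z, Finset.mem_erase.2 ⟨hzp, hz⟩, c, h, rfl⟩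
      rw [if_neg hzp]
      linarith

theorem mssCost_cons (A : List (Finset M) → M) (s : M) (r : Finset M) (σ : List (Finset M)) :
    mssCost d A s (r :: σ) = d s (A [r]) + mssCost d (fun l => A (r :: l)) (A [r]) σ := by
  rw [mssCost, mssCost, List.length_cons, Finset.sum_range_succ', add_comm]
  have h : ∀ t, mssPoint A s (r :: σ) (t + 1) =
      mssPoint (fun l => A (r :: l)) (A [r]) σ t := fun t => by
    cases t <;> simp [mssPoint]
  simp only [h]
  simp [mssPoint]

theorem onl_le_mssCost (hd : IsMetric d) (S : Finset M) (A : List (Finset M) → M) (s : M)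
    (l : List M) (σ : List (Finset M)) :
    onl d (fun l => A (l.map fun p => S.erase p)) s l ≤
      mssCost d A s (l.map (fun p => S.erase p) ++ σ) := by
  induction l generalizing A s with
  | nil => exact Finset.sum_nonneg fun t _ => hd.nonneg _ _
  | cons p l ih =>
    rw [List.map_cons, List.cons_append, mssCost_cons]
    exact add_le_add_right (ih (fun l => A (S.erase p :: l)) _) _

end Requests

/-- An admissible set with at least two points yields a distributional lower bound. -/
theorem mssDLB_of_adm {M : Type u} {d : M → M → ℝ} (hd : IsMetric d) [Finite M] {S : Finset M}
    {Δ X C : ℝ} (hΔ : 0 < Δ) (hS : ∃ x ∈ S, ∃ y ∈ S, x ≠ y)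
    (hdiam : ∀ x ∈ S, ∀ y ∈ S, d x y ≤ Δ) (hX : 0 < X) (hA : Adm d S Δ X) (hC0 : 0 ≤ C)
    (hC : C ≤ X / 128) : ∃ s, MssDLB d s (Nat.card M - 1) C := by
  have := Fintype.ofFinite M
  rw [Nat.card_eq_fintype_card]
  obtain ⟨ch, hpts, hlift, o, ho, hoff⟩ := hA
  obtain ⟨p, hp, q, hq, hpq⟩ := hS
  have hother : ∀ x ∈ S, ∃ y ∈ S, y ≠ x := fun x _ => by
    by_cases h : p = x
    · exact ⟨q, hq, h ▸ hpq.symm⟩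
    · exact ⟨p, hp, h⟩
  have hSn : S.card ≤ Fintype.card M := Finset.card_le_univ S
  have hS2 : 2 ≤ S.card := Finset.one_lt_card.2 ⟨p, hp, q, hq, hpq⟩
  set pen : M → ℝ := fun x => ⨅ y : S.erase x, 2 * d x y with hpen
  have hpen_le : ∀ x, ∀ y ∈ S, y ≠ x → pen x ≤ 2 * d x y := fun x y hy hyx =>
    ciInf_le (f := fun y : S.erase x => 2 * d x y) (Set.finite_range _).bddBelow
      ⟨y, Finset.mem_erase.2 ⟨hyx, hy⟩⟩
  have hpenOK : PenOK d S pen Δ :=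
    ⟨fun x => Real.iInf_nonneg fun y => mul_nonneg zero_le_two (hd.nonneg _ _),
      fun x _ y hy hxy => hpen_le x y hy hxy.symm, fun x hx => by
        obtain ⟨y, hy, hyx⟩ := hother x hx
        linarith [hpen_le x y hy hyx, hdiam x hx y hy]⟩
  have hpen_ge : ∀ x ∈ S, ∃ y ∈ S, y ≠ x ∧ 2 * d x y ≤ pen x := fun x hx => by
    obtain ⟨y₀, hy₀, hyx₀⟩ := hother x hx
    have : Nonempty (S.erase x) := ⟨⟨y₀, Finset.mem_erase.2 ⟨hyx₀, hy₀⟩⟩⟩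
    obtain ⟨⟨y, hy⟩, e⟩ := exists_eq_ciInf_of_finite (f := fun y : S.erase x => 2 * d x y)
    obtain ⟨hyx, hyS⟩ := Finset.mem_erase.1 hy
    exact ⟨y, hyS, hyx, e.le⟩
  refine ⟨o, fun B _ => ?_⟩
  obtain ⟨J, hJ⟩ := exists_nat_gt (B / d p q)
  have hJB : B ≤ J * d p q := ((div_lt_iff₀ (hd.pos hpq)).1 hJ).le
  obtain ⟨T, hT⟩ := exists_nat_gt (X * (3 + J))
  set tl := alternate p q (J + 1) with htl
  obtain ⟨N, P, ρ, hP0, hP1, hE, hall⟩ := (ch.rep T).exists_weights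
  set R : List M → List (Finset M) := fun l => l.map (fun p => S.erase p) ++ tl with hR
  have hsolve : ∀ l, ∃ c ≤ oc d S pen o l o + (J + 1 : ℕ) * Δ, Solves d o (R l) c := fun l =>
    exists_solves_blocked hd hpen_ge
      (fun z hz => exists_solves_alternate hdiam hp hq hz (J + 1)) o l ho
  have hopt_le : ∑ ω, P ω * mssOpt d o (R (ρ ω)) ≤ Δ * (2 * T / X) := by
    have h1 : ∑ ω, P ω * mssOpt d o (R (ρ ω)) ≤
        ∑ ω, P ω * (oc d S pen o (ρ ω) o + (J + 1 : ℕ) * Δ) :=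
      Finset.sum_le_sum fun ω _ => mul_le_mul_of_nonneg_left (by
        obtain ⟨c, hc, h⟩ := hsolve (ρ ω)
        exact (mssOpt_le hd h).trans hc) (hP0 ω)
    simp only [mul_add, Finset.sum_add_distrib] at h1
    rw [← Finset.sum_mul, hP1, ← hE fun l => oc d S pen o l o] at h1
    have h2 := hoff pen hpenOK T
    have h3 : 3 + (J : ℝ) ≤ T / X := by
      rw [le_div_iff₀ hX]
      linarith
    have h4 := mul_le_mul_of_nonneg_left h3 hΔ.le
    have e : Δ * (2 * T / X) = Δ * (T / X) + Δ * (T / X) := by ring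
    rw [e]
    push_cast at h1
    linarith
  refine ⟨N, P, fun ω => R (ρ ω), hP0, hP1, fun ω r hr => ?_, ?_, fun A hA => ?_⟩
  · rcases List.mem_append.1 hr with hr | hr
    · obtain ⟨x, hx, rfl⟩ := List.mem_map.1 hr
      have hxS : x ∈ S := hall _ (Expt.all_rep hpts T) ω x hx
      obtain ⟨y, hy, hyx⟩ := hother x hxS
      refine ⟨⟨y, Finset.mem_erase.2 ⟨hyx, hy⟩⟩, ?_⟩
      rw [Finset.card_erase_of_mem hxS]
      omega
    · rcases mem_alternate hr with rfl | rfl <;>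
        exact ⟨Finset.singleton_nonempty _, by rw [Finset.card_singleton]; omega⟩
  · have hB : ∀ l, B ≤ mssOpt d o (R l) := fun l => by
      rw [mssOpt_eq]
      obtain ⟨c, -, hc⟩ := hsolve l
      refine le_csInf ⟨c, hc⟩ fun c hc => ?_
      obtain ⟨z, c₁, h1, y, hy, c₂, h2, rfl⟩ := Solves.suffix hd hc
      rw [Finset.mem_singleton.1 hy] at h1 h2
      linarith [h2.le_alternate hd, hd.nonneg z p]
    calc B = ∑ ω, P ω * B := by rw [← Finset.sum_mul, hP1, one_mul]
      _ ≤ _ := Finset.sum_le_sum fun ω _ => mul_le_mul_of_nonneg_left (hB _) (hP0 ω)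
  · set A' : List M → M := fun l => A (l.map fun p => S.erase p) with hA'
    have hvalid : Valid S A' := fun l x => by
      have hne : (S.erase x).Nonempty := by
        by_cases hx : x ∈ S
        · obtain ⟨y, hy, hyx⟩ := hother x hx
          exact ⟨y, Finset.mem_erase.2 ⟨hyx, hy⟩⟩
        · rw [Finset.erase_eq_of_notMem hx]
          exact ⟨p, hp⟩
      have := hA (l.map fun p => S.erase p) _ hne
      simp only [hA', List.map_append, List.map_cons, List.map_nil]
      exact ⟨Finset.mem_of_mem_erase this, Finset.ne_of_mem_erase this⟩
    have h1 := lifts_rep (U := S) (by positivity : 0 ≤ Δ / 64) (hlift S) T (φ := fun _ => 0)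
      ⟨fun _ _ _ _ => rfl, fun _ _ _ hy hyS => absurd hy hyS,
        fun _ hx _ _ hxS => absurd hx hxS⟩ A' hvalid o ho
    simp only [ind, if_pos ho, zero_add, add_zero] at h1
    rw [hE] at h1
    have h2 : ∑ ω, P ω * onl d A' o (ρ ω) ≤ ∑ ω, P ω * mssCost d A o (R (ρ ω)) :=
      Finset.sum_le_sum fun ω _ =>
        mul_le_mul_of_nonneg_left (onl_le_mssCost hd S A o _ _) (hP0 ω)
    refine le_trans ?_ (h1.trans h2)
    calc C * ∑ ω, P ω * mssOpt d o (R (ρ ω)) ≤ X / 128 * (Δ * (2 * T / X)) :=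
          (mul_le_mul_of_nonneg_left hopt_le hC0).trans
            (mul_le_mul_of_nonneg_right hC (by positivity))
      _ = T * (Δ / 64) := by field_simp; ring

/-- There is an absolute constant `c > 0` such that in *every*
`n`-point metric space (`n ≥ 2`) there is a starting point `s` for which
`c·log n` is a distributional lower bound for MSS (with request sets of size at
most `n - 1`). -/
theorem mss_universal_log_lower_bound :
    ∃ c : ℝ, 0 < c ∧ ∀ n : ℕ, 2 ≤ n →
      ∀ (M : Type u) (d : M → M → ℝ), Finite M → Nat.card M = n → IsMetric d →
        ∃ s : M, MssDLB d s (n - 1) (c * Real.log n) := by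
  obtain ⟨a, ha, h⟩ := exists_adm_log.{u}
  refine ⟨1 / (256 * a), by positivity, ?_⟩
  rintro n hn M d hM rfl hd
  obtain ⟨S, Δ, X, hΔ, hS, hdiam, hA, hX, hlog⟩ := h M d hM hd hn
  have hlog0 : 0 ≤ Real.log (Nat.card M) := Real.log_natCast_nonneg _
  refine mssDLB_of_adm hd hΔ hS hdiam hX hA (by positivity) ?_
  calc 1 / (256 * a) * Real.log (Nat.card M) = Real.log (Nat.card M) / (2 * a) / 128 := by
        field_simp; ring
    _ ≤ X / 128 := by gcongr
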